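/- Ishii–Stade rearrangement of the kernel: Fix α = (α₁, α₂, α₃) ∈ ℂ³ with Re α_i = 0 and α₁ + α₂ + α₃ = 0, let μ ∈ ℂ be purely imaginary, and let s₀, s ∈ ℂ with Re s₀ = Re s = 1/2. Let σ₁ be any real number with 1/2 − 1/100 < σ₁ < 1/2. Then K_{σ₁}(s₀, s; α, μ) = 4 · γ(−(s₀+α₁)/2) · Γ((s + μ − α₁)/2) Γ((s − μ − α₁)/2) · (1/(2π))² ∫_ℝ∫_ℝ Γ(s + t) Γ((1−α₁)/2 + t) · Γ(α₂/2 + α₁/4 − z) Γ(α₃/2 + α₁/4 − z) · Γ((−s+μ)/2 + α₁/4 + z − t) Γ((−s−μ)/2 + α₁/4 + z − t) · (γ(t + s₀/2) γ(α₁/4 − z − s₀/2) / γ(α₁/4 + t − z)) dIm z dIm t, where t runs over the vertical line Re t = a and z over Re z = b for any fixed a, b with −1/2 < a < −1/4, −1/4 < b < 0, and b − a > 1/4. -/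

import Mathlib

open Complex MeasureTheory Set

/-- The kernel `K_{σ₁}(s₀, s; α, μ)`, a double Mellin–Barnes integral over
`s₁ = σ₁ + it₁` and `u = 1/100 + iv`. -/
noncomputable def Kker (σ1 : ℝ) (s0 s : ℂ) (α : Fin 3 → ℂ) (μ : ℂ) : ℂ :=
  (1 / (2 * (Real.pi : ℂ))) ^ 2 *
    ∫ t1 : ℝ, ∫ v : ℝ,
      let s1 : ℂ := (σ1 : ℝ) + t1 * Complex.I
      let u : ℂ := 1/100 + v * Complex.I
      (Complex.Gamma ((s - s1 + μ) / 2) * Complex.Gamma ((s - s1 - μ) / 2) *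
        (∏ i, Complex.Gamma ((s1 - α i) / 2)) / Complex.Gamma ((1 + s1) / 2 - s0)) *
      (Complex.Gamma (u / 2) * Complex.Gamma ((s1 - s0 + u) / 2 + 1/2 - s) *
        (∏ i, Complex.Gamma ((s0 - u + α i) / 2)) * Complex.Gamma (s - (s0 + u) / 2)) /
      (Complex.Gamma ((1 - u) / 2) * Complex.Gamma ((s0 - u + s1) / 2))

/-- The ratio `γ(x) := Γ(−x)/Γ(1/2 + x)`. -/
noncomputable def gamRatio (x : ℂ) : ℂ := Complex.Gamma (-x) / Complex.Gamma (1/2 + x)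

section GammaBounds

open Filter Topology

/-- The normalised modulus `|Γ(σ + it)| / Γ(σ)` is nondecreasing in `σ > 0`. -/
theorem norm_Gamma_mul_Gamma_le {σ σ' : ℝ} (hσ : 0 < σ) (h : σ ≤ σ') (t : ℝ) :
    ‖Gamma (σ + t * I)‖ * Real.Gamma σ' ≤ ‖Gamma (σ' + t * I)‖ * Real.Gamma σ := by
  have hσ' : 0 < σ' := hσ.trans_le h
  have hlim (x : ℝ) : Tendsto (fun n : ℕ => ‖GammaSeq (x + t * I) n‖) atTop
      (𝓝 ‖Gamma (x + t * I)‖) := (GammaSeq_tendsto_Gamma _).norm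
  refine le_of_tendsto_of_tendsto ((hlim σ).mul (Real.GammaSeq_tendsto_Gamma σ'))
    ((hlim σ').mul (Real.GammaSeq_tendsto_Gamma σ)) ?_
  filter_upwards [eventually_gt_atTop 0] with n hn
  have hn' : (0 : ℝ) < n := by exact_mod_cast hn
  have key (x : ℝ) : ‖GammaSeq (x + t * I) n‖ =
      (n : ℝ) ^ x * (n.factorial : ℝ) / ∏ j ∈ Finset.range (n + 1), ‖(x + j : ℝ) + t * I‖ := by
    rw [GammaSeq, norm_div, norm_mul, norm_prod, Complex.norm_natCast_cpow_of_pos hn]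
    simp only [add_re, ofReal_re, mul_re, I_re, mul_zero, ofReal_im, I_im, mul_one, sub_self,
      add_zero, RCLike.norm_natCast]
    congr 1
    refine Finset.prod_congr rfl fun j _ => ?_
    congr 1; push_cast; ring
  rw [key, key, Real.GammaSeq, Real.GammaSeq, div_mul_div_comm, div_mul_div_comm]
  have hpos (x : ℝ) (hx : 0 < x) : 0 < ∏ j ∈ Finset.range (n + 1), ‖((x + j : ℝ) : ℂ) + t * I‖ := by
    refine Finset.prod_pos fun j _ => norm_pos_iff.2 fun h0 => ?_
    have := congrArg Complex.re h0
    simp at this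
    have hj : (0 : ℝ) ≤ j := j.cast_nonneg
    linarith
  have hpos' (x : ℝ) (hx : 0 < x) : 0 < ∏ j ∈ Finset.range (n + 1), (x + j) :=
    Finset.prod_pos fun j _ => by positivity
  have hle : (∏ j ∈ Finset.range (n + 1), ‖((σ' + j : ℝ) : ℂ) + t * I‖) *
      ∏ j ∈ Finset.range (n + 1), (σ + j) ≤
      (∏ j ∈ Finset.range (n + 1), ‖((σ + j : ℝ) : ℂ) + t * I‖) *
      ∏ j ∈ Finset.range (n + 1), (σ' + j) := by
    rw [← Finset.prod_mul_distrib, ← Finset.prod_mul_distrib]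
    refine Finset.prod_le_prod (fun j _ => by positivity) fun j _ => ?_
    have hj : (0 : ℝ) ≤ j := j.cast_nonneg
    rw [Complex.norm_add_mul_I, Complex.norm_add_mul_I]
    refine abs_le_of_sq_le_sq' ?_ (by positivity) |>.2
    rw [mul_pow, mul_pow, Real.sq_sqrt (by positivity), Real.sq_sqrt (by positivity)]
    have h1 : (σ + j) ^ 2 ≤ (σ' + j) ^ 2 := by gcongr
    nlinarith [sq_nonneg t]
  have hnum : (n : ℝ) ^ σ * (n.factorial : ℝ) * ((n : ℝ) ^ σ' * (n.factorial : ℝ)) =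
    (n : ℝ) ^ σ' * (n.factorial : ℝ) * ((n : ℝ) ^ σ * (n.factorial : ℝ)) := by ring
  rw [hnum]
  have := mul_pos (hpos σ' hσ') (hpos' σ hσ)
  gcongr

theorem norm_Gamma_half_sq (t : ℝ) :
    ‖Gamma ((1 / 2 : ℝ) + t * I)‖ ^ 2 = Real.pi / Real.cosh (Real.pi * t) := by
  have h := Gamma_mul_Gamma_one_sub ((1 / 2 : ℝ) + t * I)
  have h1 : (1 : ℂ) - ((1 / 2 : ℝ) + t * I) = (starRingEnd ℂ) ((1 / 2 : ℝ) + t * I) := by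
    apply Complex.ext <;> simp
    norm_num
  have h2 : Complex.sin (Real.pi * ((1 / 2 : ℝ) + t * I)) = Real.cosh (Real.pi * t) := by
    rw [show (Real.pi : ℂ) * ((1 / 2 : ℝ) + t * I) = ((Real.pi * t : ℝ) : ℂ) * I + Real.pi / 2 by
      push_cast; ring, Complex.sin_add_pi_div_two, Complex.cos_mul_I, Complex.ofReal_cosh]
  rw [h1, Gamma_conj, Complex.mul_conj, h2, Complex.normSq_eq_norm_sq] at h
  exact_mod_cast h

theorem norm_Gamma_half_le (t : ℝ) :
    ‖Gamma ((1 / 2 : ℝ) + t * I)‖ ≤ 3 * Real.exp (-(Real.pi / 2 * |t|)) := by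
  refine abs_le_of_sq_le_sq' ?_ (by positivity) |>.2
  rw [norm_Gamma_half_sq, mul_pow, ← Real.exp_nat_mul, div_le_iff₀ (Real.cosh_pos _)]
  have h : Real.exp (Real.pi * |t|) / 2 ≤ Real.cosh (Real.pi * t) := by
    rw [← Real.cosh_abs, abs_mul, abs_of_pos Real.pi_pos, Real.cosh_eq]
    have := Real.exp_pos (-(Real.pi * |t|))
    linarith
  have h3 : Real.exp ((2 : ℕ) * -(Real.pi / 2 * |t|)) * Real.exp (Real.pi * |t|) = 1 := by
    rw [← Real.exp_add, ← Real.exp_zero]; congr 1; push_cast; ring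
  have := Real.pi_lt_four
  calc Real.pi ≤ 3 ^ 2 * (Real.exp ((2 : ℕ) * -(Real.pi / 2 * |t|)) *
        Real.exp (Real.pi * |t|)) / 2 := by rw [h3]; linarith
    _ = 3 ^ 2 * Real.exp ((2 : ℕ) * -(Real.pi / 2 * |t|)) * (Real.exp (Real.pi * |t|) / 2) := by
        ring
    _ ≤ _ := by gcongr

theorem inv_norm_Gamma_half_le (t : ℝ) :
    ‖Gamma ((1 / 2 : ℝ) + t * I)‖⁻¹ ≤ Real.exp (Real.pi / 2 * |t|) := by
  refine abs_le_of_sq_le_sq' ?_ (by positivity) |>.2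
  rw [inv_pow, norm_Gamma_half_sq, inv_div, ← Real.exp_nat_mul,
    div_le_iff₀ Real.pi_pos]
  have h : Real.cosh (Real.pi * t) ≤ Real.exp (Real.pi * |t|) := by
    rw [← Real.cosh_abs, abs_mul, abs_of_pos Real.pi_pos, Real.cosh_eq]
    have : Real.exp (-(Real.pi * |t|)) ≤ Real.exp (Real.pi * |t|) := by
      apply Real.exp_le_exp.2
      have : 0 ≤ Real.pi * |t| := by positivity
      linarith
    linarith
  rw [show ((2 : ℕ) : ℝ) * (Real.pi / 2 * |t|) = Real.pi * |t| by push_cast; ring]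
  have := Real.pi_gt_three
  nlinarith [Real.exp_pos (Real.pi * |t|)]

theorem norm_Gamma_nat_add_half_le (N : ℕ) : ∃ C : ℝ, 0 ≤ C ∧ ∀ t : ℝ,
    ‖Gamma ((N + 1 / 2 : ℝ) + t * I)‖ ≤
      C * (1 + |t|) ^ N * Real.exp (-(Real.pi / 2 * |t|)) := by
  induction N with
  | zero => exact ⟨3, by norm_num, fun t => by simpa using norm_Gamma_half_le t⟩
  | succ N ih =>
    obtain ⟨C, hC, h⟩ := ih
    refine ⟨C * (N + 1), by positivity, fun t => ?_⟩
    have hne : ((N + 1 / 2 : ℝ) : ℂ) + t * I ≠ 0 := fun h0 => by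
      have := congrArg Complex.re h0
      simp at this
      have hj : (0 : ℝ) ≤ N := N.cast_nonneg
      linarith
    rw [show (((N + 1 : ℕ) + 1 / 2 : ℝ) : ℂ) + t * I = ((N + 1 / 2 : ℝ) + t * I) + 1 by
      push_cast; ring, Gamma_add_one _ hne, norm_mul]
    have h1 : ‖((N + 1 / 2 : ℝ) : ℂ) + t * I‖ ≤ (N + 1) * (1 + |t|) := by
      refine (norm_add_le _ _).trans ?_
      rw [norm_mul, norm_I, mul_one, norm_real, norm_real, Real.norm_eq_abs, Real.norm_eq_abs,
        abs_of_nonneg (by positivity)]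
      have hj : (0 : ℝ) ≤ N := N.cast_nonneg
      nlinarith [abs_nonneg t]
    calc _ ≤ ((N + 1) * (1 + |t|)) * (C * (1 + |t|) ^ N * Real.exp (-(Real.pi / 2 * |t|))) := by
          gcongr; exact h t
      _ = _ := by ring

theorem Real.continuousAt_Gamma_of_pos {x : ℝ} (hx : 0 < x) : ContinuousAt Real.Gamma x :=
  (Real.differentiableAt_Gamma fun m => by
    have hm : (0 : ℝ) ≤ m := m.cast_nonneg
    linarith).continuousAt

theorem exists_Gamma_bound {r : ℝ} (hr : 0 < r) (R : ℝ) : ∃ (C : ℝ) (N : ℕ), 0 ≤ C ∧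
    ∀ z : ℂ, r ≤ z.re → z.re ≤ R →
      ‖Gamma z‖ ≤ C * (1 + |z.im|) ^ N * Real.exp (-(Real.pi / 2 * |z.im|)) := by
  obtain ⟨N, hN⟩ := exists_nat_ge R
  obtain ⟨C, hC, h⟩ := norm_Gamma_nat_add_half_le N
  have hcont : ContinuousOn Real.Gamma (Icc r R) := fun x hx =>
    (Real.continuousAt_Gamma_of_pos (hr.trans_le hx.1)).continuousWithinAt
  obtain ⟨M, hM⟩ := isCompact_Icc.exists_bound_of_continuousOn hcont
  have hG : 0 < Real.Gamma (N + 1 / 2) := Real.Gamma_pos_of_pos (by positivity)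
  refine ⟨C * |M| / Real.Gamma (N + 1 / 2), N, by positivity, fun z h1 h2 => ?_⟩
  have h3 := norm_Gamma_mul_Gamma_le (hr.trans_le h1)
    (show z.re ≤ N + 1 / 2 by linarith) z.im
  rw [re_add_im] at h3
  have h4 : Real.Gamma z.re ≤ |M| := (le_abs_self _).trans ((hM z.re ⟨h1, h2⟩).trans (le_abs_self M))
  rw [← le_div_iff₀ hG] at h3
  refine h3.trans ?_
  rw [div_mul_eq_mul_div, div_mul_eq_mul_div]
  gcongr ?_ / _
  have h0 : 0 ≤ Real.Gamma z.re := (Real.Gamma_pos_of_pos (hr.trans_le h1)).le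
  calc _ ≤ (C * (1 + |z.im|) ^ N * Real.exp (-(Real.pi / 2 * |z.im|))) * |M| := by
        gcongr; exact h _
    _ = _ := by ring

theorem exists_inv_Gamma_bound_of_half_le (R : ℝ) : ∃ C : ℝ, 0 ≤ C ∧
    ∀ z : ℂ, 1 / 2 ≤ z.re → z.re ≤ R →
      ‖(Gamma z)⁻¹‖ ≤ C * Real.exp (Real.pi / 2 * |z.im|) := by
  have hcont : ContinuousOn (fun x => (Real.Gamma x)⁻¹) (Icc (1 / 2) R) := fun x hx => by
    have hx0 : 0 < x := by linarith [hx.1]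
    exact ((Real.continuousAt_Gamma_of_pos hx0).inv₀
      (Real.Gamma_pos_of_pos hx0).ne').continuousWithinAt
  obtain ⟨M, hM⟩ := isCompact_Icc.exists_bound_of_continuousOn hcont
  have hG : 0 < Real.Gamma (1 / 2) := Real.Gamma_pos_of_pos (by positivity)
  refine ⟨Real.Gamma (1 / 2) * |M|, by positivity, fun z h1 h2 => ?_⟩
  have h3 := norm_Gamma_mul_Gamma_le (by norm_num) h1 z.im
  have h0 : 0 < z.re := by linarith
  have hz : 0 < ‖Gamma z‖ := norm_pos_iff.2 (Gamma_ne_zero_of_re_pos h0)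
  have hh : 0 < ‖Gamma ((1 / 2 : ℝ) + z.im * I)‖ :=
    norm_pos_iff.2 (Gamma_ne_zero_of_re_pos (by simp))
  rw [re_add_im] at h3
  have h4 : (Real.Gamma z.re)⁻¹ ≤ |M| :=
    (le_abs_self _).trans ((hM z.re ⟨h1, h2⟩).trans (le_abs_self M))
  have hGz : 0 < Real.Gamma z.re := Real.Gamma_pos_of_pos h0
  rw [norm_inv]
  calc ‖Gamma z‖⁻¹ ≤ Real.Gamma (1 / 2) * (Real.Gamma z.re)⁻¹ *
        ‖Gamma ((1 / 2 : ℝ) + z.im * I)‖⁻¹ := by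
        rw [mul_assoc, ← mul_inv, ← div_eq_mul_inv, le_div_iff₀ (by positivity), inv_mul_le_iff₀ hz]
        linarith
    _ ≤ _ := by
        gcongr
        exact inv_norm_Gamma_half_le _

theorem exists_inv_Gamma_bound (r R : ℝ) : ∃ (C : ℝ) (N : ℕ), 0 ≤ C ∧
    ∀ z : ℂ, r ≤ z.re → z.re ≤ R →
      ‖(Gamma z)⁻¹‖ ≤ C * (1 + |z.im|) ^ N * Real.exp (Real.pi / 2 * |z.im|) := by
  obtain ⟨n, hn⟩ := exists_nat_ge (1 / 2 - r)
  suffices H : ∀ (n : ℕ) (r R : ℝ), 1 / 2 - r ≤ n → ∃ (C : ℝ), 0 ≤ C ∧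
    ∀ z : ℂ, r ≤ z.re → z.re ≤ R →
      ‖(Gamma z)⁻¹‖ ≤ C * (1 + |z.im|) ^ n * Real.exp (Real.pi / 2 * |z.im|) by
    obtain ⟨C, h⟩ := H n r R hn
    exact ⟨C, n, h⟩
  clear! r
  intro n
  induction n with
  | zero =>
    intro r R hr
    obtain ⟨C, hC, h⟩ := exists_inv_Gamma_bound_of_half_le R
    refine ⟨C, hC, fun z h1 h2 => ?_⟩
    simpa using h z (by simp at hr; linarith) h2
  | succ n ih =>
    intro r R hr
    obtain ⟨C, hC, h⟩ := ih (r + 1) (R + 1) (by push_cast at hr; linarith)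
    refine ⟨(|r| + |R| + 1) * C, by positivity, fun z h1 h2 => ?_⟩
    have h3 := one_div_Gamma_eq_self_mul_one_div_Gamma_add_one z
    have h4 := h (z + 1) (by simpa using h1) (by simpa using h2)
    simp only [add_im, one_im, add_zero] at h4
    rw [h3, norm_mul]
    have h5 : ‖z‖ ≤ (|r| + |R| + 1) * (1 + |z.im|) := by
      refine (Complex.norm_le_abs_re_add_abs_im z).trans ?_
      have : |z.re| ≤ |r| + |R| := by
        rw [abs_le]
        constructor
        · linarith [neg_abs_le r, abs_nonneg R]
        · linarith [le_abs_self R, abs_nonneg r]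
      nlinarith [abs_nonneg z.im, abs_nonneg r, abs_nonneg R,
        mul_nonneg (abs_nonneg r) (abs_nonneg z.im), mul_nonneg (abs_nonneg R) (abs_nonneg z.im)]
    calc _ ≤ ((|r| + |R| + 1) * (1 + |z.im|)) *
          (C * (1 + |z.im|) ^ n * Real.exp (Real.pi / 2 * |z.im|)) := by gcongr
      _ = _ := by ring

end GammaBounds

section ExpBound

variable {E : Type*} [NormedAddCommGroup E]

/-- `F` is continuous and, up to a polynomial factor, bounded by `exp (-(π/2) φ)`. -/
def ExpBound (F : E → ℂ) (φ : E → ℝ) : Prop :=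
  Continuous F ∧ ∃ (C : ℝ) (N : ℕ), 0 ≤ C ∧
    ∀ e, ‖F e‖ ≤ C * (1 + ‖e‖) ^ N * Real.exp (-(Real.pi / 2 * φ e))

theorem ExpBound.mul {F G : E → ℂ} {φ ψ : E → ℝ} (hF : ExpBound F φ) (hG : ExpBound G ψ) :
    ExpBound (fun e => F e * G e) (fun e => φ e + ψ e) := by
  obtain ⟨hF, C, N, hC, h⟩ := hF
  obtain ⟨hG, C', N', hC', h'⟩ := hG
  refine ⟨hF.mul hG, C * C', N + N', by positivity, fun e => ?_⟩
  rw [norm_mul]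
  calc _ ≤ (C * (1 + ‖e‖) ^ N * Real.exp (-(Real.pi / 2 * φ e))) *
        (C' * (1 + ‖e‖) ^ N' * Real.exp (-(Real.pi / 2 * ψ e))) := by
        gcongr
        · exact h e
        · exact h' e
    _ = _ := by
        rw [show -(Real.pi / 2 * (φ e + ψ e)) =
          -(Real.pi / 2 * φ e) + -(Real.pi / 2 * ψ e) by ring, Real.exp_add]
        ring

theorem one_add_pow_le_exp (N : ℕ) {κ : ℝ} (hκ : 0 < κ) : ∃ C : ℝ, 0 ≤ C ∧ ∀ x : ℝ, 0 ≤ x →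
    (1 + x) ^ N ≤ C * Real.exp (κ * x) := by
  refine ⟨N.factorial / κ ^ N * Real.exp κ, by positivity, fun x hx => ?_⟩
  have h := Real.pow_div_factorial_le_exp (κ * (1 + x)) (by positivity) N
  rw [div_le_iff₀ (by positivity), mul_pow] at h
  rw [div_mul_eq_mul_div, div_mul_eq_mul_div, le_div_iff₀ (by positivity), mul_assoc,
    ← Real.exp_add, show κ + κ * x = κ * (1 + x) by ring]
  linarith

theorem ExpBound.exists_rpow_bound {F : E → ℂ} {φ : E → ℝ} (hF : ExpBound F φ)
    {S : Set E} {K : ℝ} (hφ : ∀ e ∈ S, ‖e‖ ≤ φ e + K) (d : ℕ) :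
    ∃ C : ℝ, 0 ≤ C ∧ ∀ e ∈ S, ‖F e‖ ≤ C * (1 + ‖e‖) ^ (-(d : ℝ)) := by
  obtain ⟨-, C, N, hC, h⟩ := hF
  obtain ⟨C', hC', h'⟩ := one_add_pow_le_exp (N + d) (show 0 < Real.pi / 2 by positivity)
  refine ⟨C * Real.exp (Real.pi / 2 * K) * C', by positivity, fun e he => (h e).trans ?_⟩
  have h1 : 0 < 1 + ‖e‖ := by positivity
  rw [Real.rpow_neg h1.le, Real.rpow_natCast, ← div_eq_mul_inv, le_div_iff₀ (by positivity)]
  have h2 : Real.exp (-(Real.pi / 2 * φ e)) ≤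
      Real.exp (Real.pi / 2 * K) * Real.exp (-(Real.pi / 2 * ‖e‖)) := by
    rw [← Real.exp_add]
    apply Real.exp_le_exp.2
    nlinarith [Real.pi_pos, hφ e he]
  set κ := Real.exp (Real.pi / 2 * K)
  calc _ ≤ C * (1 + ‖e‖) ^ N * (κ * Real.exp (-(Real.pi / 2 * ‖e‖))) * (1 + ‖e‖) ^ d := by gcongr
    _ = C * κ * (1 + ‖e‖) ^ (N + d) * Real.exp (-(Real.pi / 2 * ‖e‖)) := by ring
    _ ≤ C * κ * (C' * Real.exp (Real.pi / 2 * ‖e‖)) * Real.exp (-(Real.pi / 2 * ‖e‖)) := by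
        gcongr; exact h' _ (norm_nonneg _)
    _ = C * κ * C' * (Real.exp (Real.pi / 2 * ‖e‖) * Real.exp (-(Real.pi / 2 * ‖e‖))) := by ring
    _ = _ := by rw [← Real.exp_add]; simp

theorem one_add_abs_le_of_im {z : ℂ} {m B n : ℝ} (hB : |z.im - m| ≤ B * n) (hB0 : 0 ≤ B)
    (hn : 0 ≤ n) : 1 + |z.im| ≤ (1 + |m| + B) * (1 + n) := by
  have : |z.im| ≤ |m| + B * n := by
    calc |z.im| = |m + (z.im - m)| := by congr 1; ring
      _ ≤ _ := (abs_add_le _ _).trans (by gcongr)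
  nlinarith [abs_nonneg m, mul_nonneg (abs_nonneg m) hn]

variable [NormedSpace ℝ E]

theorem expBound_Gamma {g : E → ℂ} {r R m : ℝ} (L : E →L[ℝ] ℝ) (hg : Continuous g) (hr : 0 < r)
    (hre : ∀ e, r ≤ (g e).re ∧ (g e).re ≤ R) (him : ∀ e, (g e).im = m + L e) :
    ExpBound (fun e => Gamma (g e)) (fun e => |L e|) := by
  refine ⟨continuous_iff_continuousAt.2 fun e => ?_, ?_⟩
  · refine ContinuousAt.comp (f := g) (g := Gamma) ?_ hg.continuousAt
    refine (differentiableAt_Gamma _ fun k h0 => ?_).continuousAt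
    have h1 := (hre e).1
    rw [h0] at h1
    simp only [neg_re, natCast_re] at h1
    linarith [(k.cast_nonneg : (0 : ℝ) ≤ k)]
  · obtain ⟨C, N, hC, h⟩ := exists_Gamma_bound hr R
    refine ⟨C * (1 + |m| + ‖L‖) ^ N * Real.exp (Real.pi / 2 * |m|), N, by positivity, fun e => ?_⟩
    refine (h (g e) (hre e).1 (hre e).2).trans ?_
    have h1 : 1 + |(g e).im| ≤ (1 + |m| + ‖L‖) * (1 + ‖e‖) :=
      one_add_abs_le_of_im (by rw [him, add_sub_cancel_left]; exact L.le_opNorm e)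
        (norm_nonneg _) (norm_nonneg _)
    have h2 : |L e| - |m| ≤ |(g e).im| := by
      rw [him, add_comm]; simpa using abs_sub_abs_le_abs_sub (L e) (-m)
    have h3 : Real.exp (-(Real.pi / 2 * |(g e).im|)) ≤
        Real.exp (Real.pi / 2 * |m|) * Real.exp (-(Real.pi / 2 * |L e|)) := by
      rw [← Real.exp_add]
      apply Real.exp_le_exp.2
      nlinarith [Real.pi_pos]
    calc _ ≤ C * ((1 + |m| + ‖L‖) * (1 + ‖e‖)) ^ N *
          (Real.exp (Real.pi / 2 * |m|) * Real.exp (-(Real.pi / 2 * |L e|))) := by gcongr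
      _ = _ := by rw [mul_pow]; ring

theorem expBound_inv_Gamma {g : E → ℂ} {r R m : ℝ} (L : E →L[ℝ] ℝ) (hg : Continuous g)
    (hre : ∀ e, r ≤ (g e).re ∧ (g e).re ≤ R) (him : ∀ e, (g e).im = m + L e) :
    ExpBound (fun e => (Gamma (g e))⁻¹) (fun e => -|L e|) := by
  refine ⟨differentiable_one_div_Gamma.continuous.comp hg, ?_⟩
  obtain ⟨C, N, hC, h⟩ := exists_inv_Gamma_bound r R
  refine ⟨C * (1 + |m| + ‖L‖) ^ N * Real.exp (Real.pi / 2 * |m|), N, by positivity, fun e => ?_⟩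
  refine (h (g e) (hre e).1 (hre e).2).trans ?_
  have h1 : 1 + |(g e).im| ≤ (1 + |m| + ‖L‖) * (1 + ‖e‖) :=
    one_add_abs_le_of_im (by rw [him, add_sub_cancel_left]; exact L.le_opNorm e)
      (norm_nonneg _) (norm_nonneg _)
  have h2 : |(g e).im| ≤ |m| + |L e| := by
    rw [him]; exact abs_add_le _ _
  have h3 : Real.exp (Real.pi / 2 * |(g e).im|) ≤
      Real.exp (Real.pi / 2 * |m|) * Real.exp (-(Real.pi / 2 * -|L e|)) := by
    rw [← Real.exp_add]
    apply Real.exp_le_exp.2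
    nlinarith [Real.pi_pos]
  calc _ ≤ C * ((1 + |m| + ‖L‖) * (1 + ‖e‖)) ^ N *
        (Real.exp (Real.pi / 2 * |m|) * Real.exp (-(Real.pi / 2 * -|L e|))) := by gcongr
    _ = _ := by rw [mul_pow]; ring

theorem ExpBound.integrable [MeasurableSpace E] [BorelSpace E] [FiniteDimensional ℝ E]
    {μ : Measure E} [μ.IsAddHaarMeasure] {F : E → ℂ} {φ : E → ℝ} (hF : ExpBound F φ)
    (hφ : ∀ e, ‖e‖ ≤ φ e) : Integrable F μ := by
  obtain ⟨C, -, h⟩ := hF.exists_rpow_bound (S := Set.univ) (K := 0) (by simpa using hφ)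
    (Module.finrank ℝ E + 1)
  have h1 : Integrable (fun e : E => C * (1 + ‖e‖) ^ (-((Module.finrank ℝ E + 1 : ℕ) : ℝ))) μ :=
    (integrable_one_add_norm (by push_cast; linarith)).const_mul C
  exact h1.mono' hF.1.aestronglyMeasurable (Filter.Eventually.of_forall fun e => h e trivial)

end ExpBound

section Barnes

open scoped FourierTransform

/-- The Beta integrand after the substitution `x = sigmoid u`. -/
noncomputable def betaKernel (a c : ℂ) (u : ℝ) : ℂ :=
  (Real.sigmoid u : ℂ) ^ a * (Real.sigmoid (-u) : ℂ) ^ c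

theorem continuous_betaKernel (a c : ℂ) : Continuous (betaKernel a c) := by
  have h (a : ℂ) : Continuous fun u : ℝ => (Real.sigmoid u : ℂ) ^ a :=
    (continuous_ofReal.comp continuous_sigmoid).cpow continuous_const fun u =>
      Or.inl (by simpa using Real.sigmoid_pos u)
  exact (h a).mul ((h c).comp continuous_neg)

theorem betaKernel_subst (a c : ℂ) (u : ℝ) :
    |Real.sigmoid u * (1 - Real.sigmoid u)| •
      ((Real.sigmoid u : ℂ) ^ (a - 1) * (1 - (Real.sigmoid u : ℂ)) ^ (c - 1)) =
      betaKernel a c u := by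
  have h1 := Real.sigmoid_pos u
  have h2 := Real.sigmoid_pos (-u)
  have h3 := Real.sigmoid_neg u
  rw [← h3, abs_of_pos (by positivity), show (1 - (Real.sigmoid u : ℂ)) = (Real.sigmoid (-u) : ℝ) by
    rw [h3]; push_cast; ring, betaKernel, cpow_sub _ _ (by exact_mod_cast h1.ne'),
    cpow_sub _ _ (by exact_mod_cast h2.ne'), cpow_one, cpow_one, real_smul]
  have h1' : (Real.sigmoid u : ℂ) ≠ 0 := by exact_mod_cast h1.ne'
  have h2' : (Real.sigmoid (-u) : ℂ) ≠ 0 := by exact_mod_cast h2.ne'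
  push_cast
  field_simp

theorem integrable_betaKernel {a c : ℂ} (ha : 0 < a.re) (hc : 0 < c.re) :
    Integrable (betaKernel a c) := by
  have h := betaIntegral_convergent ha hc
  rw [intervalIntegrable_iff_integrableOn_Ioo_of_le zero_le_one, ← Real.range_sigmoid,
    ← image_univ, integrableOn_image_iff_integrableOn_abs_deriv_smul MeasurableSet.univ
      (fun x _ => (Real.hasDerivAt_sigmoid x).hasDerivWithinAt)
      (Real.sigmoid_injective.injOn), integrableOn_univ] at h
  simpa only [betaKernel_subst] using h

theorem integral_betaKernel {a c : ℂ} (ha : 0 < a.re) (hc : 0 < c.re) :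
    ∫ u, betaKernel a c u = Gamma a * Gamma c / Gamma (a + c) := by
  rw [← betaIntegral_eq_Gamma_mul_div a c ha hc, betaIntegral,
    intervalIntegral.integral_of_le zero_le_one, integral_Ioc_eq_integral_Ioo,
    ← Real.range_sigmoid, ← image_univ, integral_image_eq_integral_abs_deriv_smul
      MeasurableSet.univ (fun x _ => (Real.hasDerivAt_sigmoid x).hasDerivWithinAt)
      (Real.sigmoid_injective.injOn), Measure.restrict_univ]
  simp only [betaKernel_subst]

theorem betaKernel_twist (a c : ℂ) (y u : ℝ) :
    betaKernel (a - y * I) (c + y * I) u = cexp (-(u * y : ℝ) * I) * betaKernel a c u := by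
  have h1 := Real.sigmoid_pos u
  have h2 := Real.sigmoid_pos (-u)
  have h1' : (Real.sigmoid u : ℂ) ≠ 0 := by exact_mod_cast h1.ne'
  have h2' : (Real.sigmoid (-u) : ℂ) ≠ 0 := by exact_mod_cast h2.ne'
  have h3 := Real.sigmoid_mul_rexp_neg u
  have h4 : Real.log (Real.sigmoid (-u)) = Real.log (Real.sigmoid u) - u := by
    rw [← h3, Real.log_mul h1.ne' (Real.exp_pos _).ne', Real.log_exp]; ring
  rw [betaKernel, betaKernel, cpow_def_of_ne_zero h1', cpow_def_of_ne_zero h2',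
    cpow_def_of_ne_zero h1', cpow_def_of_ne_zero h2', ← ofReal_log h1.le, ← ofReal_log h2.le, h4,
    ← Complex.exp_add, ← Complex.exp_add, ← Complex.exp_add]
  congr 1
  push_cast
  ring

theorem fourier_betaKernel {a c : ℂ} (ha : 0 < a.re) (hc : 0 < c.re) (ξ : ℝ) :
    𝓕 (betaKernel a c) ξ =
      Gamma (a - (2 * Real.pi * ξ : ℝ) * I) * Gamma (c + (2 * Real.pi * ξ : ℝ) * I) /
        Gamma (a + c) := by
  have h := integral_betaKernel (a := a - (2 * Real.pi * ξ : ℝ) * I)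
    (c := c + (2 * Real.pi * ξ : ℝ) * I) (by simpa using ha) (by simpa using hc)
  rw [show a - (2 * Real.pi * ξ : ℝ) * I + (c + (2 * Real.pi * ξ : ℝ) * I) = a + c by ring] at h
  rw [← h, Real.fourier_real_eq]
  refine integral_congr_ae (Filter.Eventually.of_forall fun u => ?_)
  simp only [betaKernel_twist, Circle.smul_def, Real.fourierChar_apply, smul_eq_mul]
  congr 2
  push_cast
  ring

theorem expBound_Gamma_add {a : ℂ} (ha : 0 < a.re) :
    ExpBound (fun y : ℝ => Gamma (a + y * I)) (fun y => |y|) :=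
  expBound_Gamma (R := a.re) (m := a.im) (ContinuousLinearMap.id ℝ ℝ) (by fun_prop) ha
    (fun e => by simp) (fun e => by simp)

theorem expBound_Gamma_sub {a : ℂ} (ha : 0 < a.re) :
    ExpBound (fun y : ℝ => Gamma (a - y * I)) (fun y => |y|) := by
  simpa using expBound_Gamma (g := fun y : ℝ => a - y * I) (R := a.re) (m := a.im)
    (-ContinuousLinearMap.id ℝ ℝ) (by fun_prop) ha
    (fun e => by simp) (fun e => by simp [sub_eq_add_neg])

theorem integrable_Gamma_mul_Gamma {a c : ℂ} (ha : 0 < a.re) (hc : 0 < c.re) :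
    Integrable fun y : ℝ => Gamma (a - y * I) * Gamma (c + y * I) :=
  ((expBound_Gamma_sub ha).mul (expBound_Gamma_add hc)).integrable fun e => by
    simp only [Real.norm_eq_abs]; linarith [abs_nonneg e]

theorem integrable_fourier_betaKernel {a c : ℂ} (ha : 0 < a.re) (hc : 0 < c.re) :
    Integrable (𝓕 (betaKernel a c)) := by
  have h := ((integrable_Gamma_mul_Gamma ha hc).comp_mul_left'
    (R := 2 * Real.pi) (by positivity)).div_const (Gamma (a + c))
  exact h.congr (Filter.Eventually.of_forall fun ξ => (fourier_betaKernel ha hc ξ).symm)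

/-- **Barnes' first lemma.** -/
theorem barnes_first {a b c d : ℂ} (ha : 0 < a.re) (hb : 0 < b.re) (hc : 0 < c.re)
    (hd : 0 < d.re) :
    ∫ y : ℝ, Gamma (a + y * I) * Gamma (b + y * I) * Gamma (c - y * I) * Gamma (d - y * I) =
      2 * Real.pi * (Gamma (a + c) * Gamma (a + d) * Gamma (b + c) * Gamma (b + d) /
        Gamma (a + b + c + d)) := by
  have hinv (u : ℝ) : 𝓕 (𝓕 (betaKernel d b)) u = betaKernel d b (-u) := by
    have h := congrFun ((continuous_betaKernel d b).fourierInv_fourier_eq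
      (integrable_betaKernel hd hb) (integrable_fourier_betaKernel hd hb)) (-u)
    rwa [Real.fourierInv_eq_fourier_neg, neg_neg] at h
  have hpars : ∫ ξ : ℝ, 𝓕 (betaKernel c a) ξ * 𝓕 (betaKernel d b) ξ =
      ∫ u : ℝ, betaKernel c a u * 𝓕 (𝓕 (betaKernel d b)) u := by
    have := VectorFourier.integral_fourierIntegral_smul_eq_flip (L := innerₗ ℝ)
      (μ := volume) (ν := volume) (f := betaKernel c a) (g := 𝓕 (betaKernel d b))
      Real.continuous_fourierChar continuous_inner
      (integrable_betaKernel hc ha) (integrable_fourier_betaKernel hd hb)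
    simpa using! this
  have hker (u : ℝ) : betaKernel c a u * betaKernel d b (-u) = betaKernel (b + c) (a + d) u := by
    have h1' : (Real.sigmoid u : ℂ) ≠ 0 := by exact_mod_cast (Real.sigmoid_pos u).ne'
    have h2' : (Real.sigmoid (-u) : ℂ) ≠ 0 := by exact_mod_cast (Real.sigmoid_pos (-u)).ne'
    rw [betaKernel, betaKernel, betaKernel, neg_neg, cpow_add _ _ h1', cpow_add _ _ h2']
    ring
  simp only [hinv, hker, fourier_betaKernel hc ha, fourier_betaKernel hd hb] at hpars
  rw [integral_betaKernel (by simp; linarith) (by simp; linarith)] at hpars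
  have hscale := Measure.integral_comp_mul_left (fun y : ℝ =>
    Gamma (c - y * I) * Gamma (a + y * I) / Gamma (c + a) *
      (Gamma (d - y * I) * Gamma (b + y * I) / Gamma (d + b))) (2 * Real.pi)
  rw [hscale] at hpars
  have h1 : Gamma (c + a) ≠ 0 := Gamma_ne_zero_of_re_pos (by simp; linarith)
  have h2 : Gamma (d + b) ≠ 0 := Gamma_ne_zero_of_re_pos (by simp; linarith)
  have hcongr : (∫ y : ℝ, Gamma (c - y * I) * Gamma (a + y * I) / Gamma (c + a) *
      (Gamma (d - y * I) * Gamma (b + y * I) / Gamma (d + b))) =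
      (∫ y : ℝ, Gamma (a + y * I) * Gamma (b + y * I) * Gamma (c - y * I) * Gamma (d - y * I)) /
        (Gamma (c + a) * Gamma (d + b)) := by
    rw [← integral_div]
    refine integral_congr_ae (Filter.Eventually.of_forall fun y => ?_)
    field_simp
  rw [hcongr, abs_of_pos (by positivity), real_smul] at hpars
  have hpi : (Real.pi : ℂ) ≠ 0 := by exact_mod_cast Real.pi_ne_zero
  rw [show b + c + (a + d) = a + b + c + d by ring] at hpars
  rw [add_comm a c, add_comm b d, add_comm c a, add_comm d b] at *
  push_cast at hpars
  field_simp at hpars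
  rw [hpars]
  ring

end Barnes

section BarnesConsequences

/-- Coordinate form of `expBound_Gamma` on the plane. -/
theorem expBound_Gamma_prod {p : ℂ} (hp : 0 < p.re) (k l : ℝ) :
    ExpBound (fun e : ℝ × ℝ => Gamma (p + (k * e.1 + l * e.2 : ℝ) * I))
      (fun e => |k * e.1 + l * e.2|) :=
  expBound_Gamma (R := p.re) (m := p.im)
    (k • ContinuousLinearMap.fst ℝ ℝ ℝ + l • ContinuousLinearMap.snd ℝ ℝ ℝ) (by fun_prop) hp
    (fun e => by simp) (fun e => by simp)

/-- Coordinate form of `expBound_inv_Gamma` on the plane. -/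
theorem expBound_inv_Gamma_prod (p : ℂ) (k l : ℝ) :
    ExpBound (fun e : ℝ × ℝ => (Gamma (p + (k * e.1 + l * e.2 : ℝ) * I))⁻¹)
      (fun e => -|k * e.1 + l * e.2|) :=
  expBound_inv_Gamma (r := p.re) (R := p.re) (m := p.im)
    (k • ContinuousLinearMap.fst ℝ ℝ ℝ + l • ContinuousLinearMap.snd ℝ ℝ ℝ) (by fun_prop)
    (fun e => by simp) (fun e => by simp)

theorem prod_norm_le_abs_add_abs (e : ℝ × ℝ) : ‖e‖ ≤ |e.1| + |e.2| := by
  rw [Prod.norm_def, Real.norm_eq_abs, Real.norm_eq_abs]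
  exact max_le (by linarith [abs_nonneg e.2]) (by linarith [abs_nonneg e.1])

/-- A Thomae-type transformation of `₃F₂(1)` Barnes integrals. -/
theorem barnes_thomae {a b c d e f r : ℂ} (hc : 0 < c.re)
    (hd : 0 < d.re) (he : 0 < e.re) (hr : 0 < r.re) (hra : r.re < a.re) (hrb : r.re < b.re)
    (hrf : 0 < (f - a - b + r).re) :
    Gamma (f - a) * Gamma (f - b) *
      ∫ y : ℝ, Gamma (a + y * I) * Gamma (b + y * I) * Gamma (c + y * I) * Gamma (d - y * I) *
        Gamma (e - y * I) / Gamma (f + y * I) =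
    Gamma (c + d) * Gamma (c + e) *
      ∫ v : ℝ, Gamma (d + r + v * I) * Gamma (e + r + v * I) * Gamma (f - a - b + r + v * I) *
        Gamma (a - r - v * I) * Gamma (b - r - v * I) / Gamma (c + d + e + r + v * I) := by
  have hpi : (2 * Real.pi : ℂ) ≠ 0 := by simp [Real.pi_ne_zero]
  have har : 0 < (a - r).re := by simpa using hra
  have hbr : 0 < (b - r).re := by simpa using hrb
  set Φ : ℝ → ℝ → ℂ := fun y v => Gamma (r + y * I + v * I) *
    (Gamma (f - a - b + r + v * I) * Gamma (a - r - v * I) * Gamma (b - r - v * I)) *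
    (Gamma (c + y * I) * Gamma (d - y * I) * Gamma (e - y * I)) with hΦ
  have hΦint : Integrable (Function.uncurry Φ) (volume.prod volume) := by
    have h := ((expBound_Gamma_prod hr 1 1).mul (((expBound_Gamma_prod hrf 0 1).mul
      (expBound_Gamma_prod har 0 (-1))).mul (expBound_Gamma_prod hbr 0 (-1)))).mul
      (((expBound_Gamma_prod hc 1 0).mul (expBound_Gamma_prod hd (-1) 0)).mul
        (expBound_Gamma_prod he (-1) 0))
    have h2 := h.integrable (μ := volume) fun e => by
      refine (prod_norm_le_abs_add_abs e).trans ?_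
      simp only [one_mul, zero_mul, zero_add, add_zero, neg_mul, abs_neg]
      linarith [abs_nonneg e.1, abs_nonneg e.2, abs_nonneg (e.1 + e.2)]
    refine h2.congr (Filter.Eventually.of_forall fun e => ?_)
    simp only [hΦ, Function.uncurry]
    push_cast
    ring_nf
  have h1 (y : ℝ) : ∫ v : ℝ, Φ y v = 2 * Real.pi * (Gamma (f - a) * Gamma (f - b)) *
      (Gamma (a + y * I) * Gamma (b + y * I) * Gamma (c + y * I) * Gamma (d - y * I) *
        Gamma (e - y * I) / Gamma (f + y * I)) := by
    have h := barnes_first (a := r + y * I) (b := f - a - b + r) (c := a - r) (d := b - r)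
      (by simpa using hr) hrf har hbr
    rw [show r + y * I + (a - r) = a + y * I by ring, show r + y * I + (b - r) = b + y * I by ring,
      show f - a - b + r + (a - r) = f - b by ring, show f - a - b + r + (b - r) = f - a by ring,
      show r + y * I + (f - a - b + r) + (a - r) + (b - r) = f + y * I by ring] at h
    simp only [hΦ]
    rw [integral_mul_const]
    simp only [← mul_assoc]
    rw [h]
    ring
  have h2 (v : ℝ) : ∫ y : ℝ, Φ y v = 2 * Real.pi * (Gamma (c + d) * Gamma (c + e)) *
      (Gamma (d + r + v * I) * Gamma (e + r + v * I) * Gamma (f - a - b + r + v * I) *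
        Gamma (a - r - v * I) * Gamma (b - r - v * I) / Gamma (c + d + e + r + v * I)) := by
    have h := barnes_first (a := r + v * I) (b := c) (c := d) (d := e)
      (by simpa using hr) hc hd he
    rw [show r + v * I + d = d + r + v * I by ring, show r + v * I + e = e + r + v * I by ring,
      show r + v * I + c + d + e = c + d + e + r + v * I by ring] at h
    have hcongr : ∀ y : ℝ, Φ y v =
        (Gamma (f - a - b + r + v * I) * Gamma (a - r - v * I) * Gamma (b - r - v * I)) *
        (Gamma (r + v * I + y * I) * Gamma (c + y * I) * Gamma (d - y * I) *
          Gamma (e - y * I)) := fun y => by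
      simp only [hΦ]
      rw [show r + y * I + v * I = r + v * I + y * I by ring]
      ring
    simp only [hcongr]
    rw [integral_const_mul, h]
    ring
  have hswap := integral_integral_swap hΦint
  simp only [h1, h2] at hswap
  rw [integral_const_mul, integral_const_mul, mul_assoc, mul_assoc (2 * Real.pi : ℂ)] at hswap
  exact mul_left_cancel₀ hpi hswap

/-- **Barnes' second lemma.** -/
theorem barnes_second {a b c d e : ℂ} (ha : 0 < a.re) (hb : 0 < b.re) (hc : 0 < c.re)
    (hd : 0 < d.re) (he : 0 < e.re) :
    ∫ y : ℝ, Gamma (a + y * I) * Gamma (b + y * I) * Gamma (c + y * I) * Gamma (d - y * I) *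
        Gamma (e - y * I) / Gamma (a + b + c + d + e + y * I) =
      2 * Real.pi * (Gamma (a + d) * Gamma (a + e) * Gamma (b + d) * Gamma (b + e) *
        Gamma (c + d) * Gamma (c + e) /
          (Gamma (b + c + d + e) * Gamma (a + c + d + e) * Gamma (a + b + d + e))) := by
  obtain ⟨r, hr, hrab⟩ := exists_between (lt_min ha hb)
  obtain ⟨hra, hrb⟩ := lt_min_iff.1 hrab
  have h := barnes_thomae (f := a + b + c + d + e) (r := r) (a := a) (b := b) hc hd he
    (by simpa using hr) (by simpa using hra) (by simpa using hrb) (by simp; linarith)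
  rw [show a + b + c + d + e - a = b + c + d + e by ring,
    show a + b + c + d + e - b = a + c + d + e by ring,
    show b + c + d + e - b = c + d + e by ring] at h
  have h1 := barnes_first (a := d + r) (b := e + r) (c := a - r) (d := b - r)
    (by simp; linarith) (by simp; linarith) (by simpa using hra) (by simpa using hrb)
  have hcancel (v : ℝ) : Gamma (d + r + v * I) * Gamma (e + r + v * I) *
      Gamma (c + d + e + r + v * I) * Gamma (a - r - v * I) * Gamma (b - r - v * I) /
        Gamma (c + d + e + r + v * I) =
      Gamma (d + r + v * I) * Gamma (e + r + v * I) * Gamma (a - r - v * I) *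
        Gamma (b - r - v * I) := by
    have : Gamma (c + d + e + r + v * I) ≠ 0 := Gamma_ne_zero_of_re_pos (by simp; linarith)
    field_simp
  simp only [hcancel] at h
  rw [h1, show d + r + (a - r) = a + d by ring, show d + r + (b - r) = b + d by ring,
    show e + r + (a - r) = a + e by ring, show e + r + (b - r) = b + e by ring,
    show d + r + (e + r) + (a - r) + (b - r) = a + b + d + e by ring] at h
  have g1 : Gamma (b + c + d + e) ≠ 0 := Gamma_ne_zero_of_re_pos (by simp; linarith)
  have g2 : Gamma (a + c + d + e) ≠ 0 := Gamma_ne_zero_of_re_pos (by simp; linarith)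
  have g3 : Gamma (a + b + d + e) ≠ 0 := Gamma_ne_zero_of_re_pos (by simp; linarith)
  refine mul_left_cancel₀ (mul_ne_zero g1 g2) (h.trans ?_)
  field_simp

/-- Two-term transformation of balanced (Saalschützian) Barnes integrals. -/
theorem barnes_balanced {a₁ a₂ a₃ a₄ b₁ b₂ c d r : ℂ} (ha₃ : 0 < a₃.re)
    (ha₄ : 0 < a₄.re) (hb₁ : 0 < b₁.re) (hb₂ : 0 < b₂.re)
    (hbal : c + d = a₁ + a₂ + a₃ + a₄ + b₁ + b₂) (hr : 0 < r.re) (hra₁ : r.re < a₁.re)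
    (hra₂ : r.re < a₂.re) (hrc : 0 < (c - a₁ - a₂ + r).re) (hrd : 0 < (d - a₁ - a₂ + r).re) :
    Gamma (c - a₁) * Gamma (c - a₂) * Gamma (d - a₁) * Gamma (d - a₂) *
      ∫ y : ℝ, Gamma (a₁ + y * I) * Gamma (a₂ + y * I) * Gamma (a₃ + y * I) * Gamma (a₄ + y * I) *
        Gamma (b₁ - y * I) * Gamma (b₂ - y * I) / (Gamma (c + y * I) * Gamma (d + y * I)) =
    Gamma (a₃ + b₁) * Gamma (a₃ + b₂) * Gamma (a₄ + b₁) * Gamma (a₄ + b₂) *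
      ∫ v : ℝ, Gamma (c - a₁ - a₂ + r + v * I) * Gamma (d - a₁ - a₂ + r + v * I) *
        Gamma (b₁ + r + v * I) * Gamma (b₂ + r + v * I) *
        Gamma (a₁ - r - v * I) * Gamma (a₂ - r - v * I) /
          (Gamma (a₃ + b₁ + b₂ + r + v * I) * Gamma (a₄ + b₁ + b₂ + r + v * I)) := by
  have hpi : (2 * Real.pi : ℂ) ≠ 0 := by simp [Real.pi_ne_zero]
  have h1r : 0 < (a₁ - r).re := by simpa using hra₁
  have h2r : 0 < (a₂ - r).re := by simpa using hra₂
  obtain ⟨κ, hκ⟩ : ∃ κ, κ = a₃ + a₄ + b₁ + b₂ := ⟨_, rfl⟩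
  have hκ' : κ = c + d - a₁ - a₂ := by rw [hκ, hbal]; ring
  have hκne : Gamma κ ≠ 0 := Gamma_ne_zero_of_re_pos (by rw [hκ]; simp; linarith)
  set Φ : ℝ → ℝ → ℂ := fun y v => Gamma (r + y * I + v * I) *
    (Gamma (c - a₁ - a₂ + r + v * I) * Gamma (d - a₁ - a₂ + r + v * I) * Gamma (a₁ - r - v * I) *
      Gamma (a₂ - r - v * I)) *
    (Gamma (a₃ + y * I) * Gamma (a₄ + y * I) * Gamma (b₁ - y * I) * Gamma (b₂ - y * I)) *
    (Gamma (κ + r + y * I + v * I))⁻¹ with hΦ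
  have hΦint : Integrable (Function.uncurry Φ) (volume.prod volume) := by
    have h := (((expBound_Gamma_prod hr 1 1).mul ((((expBound_Gamma_prod hrc 0 1).mul
      (expBound_Gamma_prod hrd 0 1)).mul (expBound_Gamma_prod h1r 0 (-1))).mul
      (expBound_Gamma_prod h2r 0 (-1)))).mul
      ((((expBound_Gamma_prod ha₃ 1 0).mul (expBound_Gamma_prod ha₄ 1 0)).mul
        (expBound_Gamma_prod hb₁ (-1) 0)).mul (expBound_Gamma_prod hb₂ (-1) 0))).mul
      (expBound_inv_Gamma_prod (κ + r) 1 1)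
    have h2 := h.integrable (μ := volume) fun e => by
      refine (prod_norm_le_abs_add_abs e).trans ?_
      simp only [one_mul, zero_mul, zero_add, add_zero, neg_mul, abs_neg]
      linarith [abs_nonneg e.1, abs_nonneg e.2]
    refine h2.congr (Filter.Eventually.of_forall fun e => ?_)
    simp only [hΦ, Function.uncurry]
    push_cast
    ring_nf
  have h1 (y : ℝ) : ∫ v : ℝ, Φ y v =
      (2 * Real.pi / Gamma κ) * (Gamma (c - a₁) * Gamma (c - a₂) * Gamma (d - a₁) *
        Gamma (d - a₂)) *
      (Gamma (a₁ + y * I) * Gamma (a₂ + y * I) * Gamma (a₃ + y * I) * Gamma (a₄ + y * I) *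
        Gamma (b₁ - y * I) * Gamma (b₂ - y * I) / (Gamma (c + y * I) * Gamma (d + y * I))) := by
    have h := barnes_second (a := r + y * I) (b := c - a₁ - a₂ + r) (c := d - a₁ - a₂ + r)
      (d := a₁ - r) (e := a₂ - r) (by simpa using hr) hrc hrd h1r h2r
    rw [show r + y * I + (a₁ - r) = a₁ + y * I by ring,
      show r + y * I + (a₂ - r) = a₂ + y * I by ring,
      show c - a₁ - a₂ + r + (a₁ - r) = c - a₂ by ring,
      show c - a₁ - a₂ + r + (a₂ - r) = c - a₁ by ring,
      show d - a₁ - a₂ + r + (a₁ - r) = d - a₂ by ring,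
      show d - a₁ - a₂ + r + (a₂ - r) = d - a₁ by ring,
      show c - a₁ - a₂ + r + (d - a₁ - a₂ + r) + (a₁ - r) + (a₂ - r) = κ by rw [hκ']; ring,
      show r + y * I + (d - a₁ - a₂ + r) + (a₁ - r) + (a₂ - r) = d + y * I by ring,
      show r + y * I + (c - a₁ - a₂ + r) + (a₁ - r) + (a₂ - r) = c + y * I by ring,
      show r + y * I + (c - a₁ - a₂ + r) + (d - a₁ - a₂ + r) + (a₁ - r) + (a₂ - r) =
        κ + r + y * I by rw [hκ']; ring] at h
    have hcongr : ∀ v : ℝ, Φ y v =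
        (Gamma (a₃ + y * I) * Gamma (a₄ + y * I) * Gamma (b₁ - y * I) * Gamma (b₂ - y * I)) *
        (Gamma (r + y * I + v * I) * Gamma (c - a₁ - a₂ + r + v * I) *
          Gamma (d - a₁ - a₂ + r + v * I) * Gamma (a₁ - r - v * I) *
          Gamma (a₂ - r - v * I) / Gamma (κ + r + y * I + v * I)) := fun v => by
      simp only [hΦ]
      ring
    simp only [hcongr]
    rw [integral_const_mul, h]
    simp only [div_eq_mul_inv, mul_inv]
    ring
  have h2 (v : ℝ) : ∫ y : ℝ, Φ y v =
      (2 * Real.pi / Gamma κ) * (Gamma (a₃ + b₁) * Gamma (a₃ + b₂) * Gamma (a₄ + b₁) *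
        Gamma (a₄ + b₂)) *
      (Gamma (c - a₁ - a₂ + r + v * I) * Gamma (d - a₁ - a₂ + r + v * I) *
        Gamma (b₁ + r + v * I) * Gamma (b₂ + r + v * I) *
        Gamma (a₁ - r - v * I) * Gamma (a₂ - r - v * I) /
          (Gamma (a₃ + b₁ + b₂ + r + v * I) * Gamma (a₄ + b₁ + b₂ + r + v * I))) := by
    have h := barnes_second (a := r + v * I) (b := a₃) (c := a₄) (d := b₁) (e := b₂)
      (by simpa using hr) ha₃ ha₄ hb₁ hb₂
    rw [show r + v * I + b₁ = b₁ + r + v * I by ring,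
      show r + v * I + b₂ = b₂ + r + v * I by ring, ← hκ,
      show r + v * I + a₄ + b₁ + b₂ = a₄ + b₁ + b₂ + r + v * I by ring,
      show r + v * I + a₃ + b₁ + b₂ = a₃ + b₁ + b₂ + r + v * I by ring,
      show r + v * I + a₃ + a₄ + b₁ + b₂ = κ + r + v * I by rw [hκ]; ring] at h
    have hcongr : ∀ y : ℝ, Φ y v =
        (Gamma (c - a₁ - a₂ + r + v * I) * Gamma (d - a₁ - a₂ + r + v * I) *
          Gamma (a₁ - r - v * I) * Gamma (a₂ - r - v * I)) *
        (Gamma (r + v * I + y * I) * Gamma (a₃ + y * I) * Gamma (a₄ + y * I) *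
          Gamma (b₁ - y * I) * Gamma (b₂ - y * I) / Gamma (κ + r + v * I + y * I)) := fun y => by
      simp only [hΦ]
      rw [show r + y * I + v * I = r + v * I + y * I by ring,
        show κ + r + y * I + v * I = κ + r + v * I + y * I by ring]
      ring
    simp only [hcongr]
    rw [integral_const_mul, h]
    simp only [div_eq_mul_inv, mul_inv]
    ring
  have hswap := integral_integral_swap hΦint
  simp only [h1, h2] at hswap
  rw [integral_const_mul, integral_const_mul, mul_assoc, mul_assoc (2 * Real.pi / Gamma κ : ℂ)]
    at hswap
  exact mul_left_cancel₀ (div_ne_zero hpi hκne) hswap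

end BarnesConsequences

section ContourShift

open Filter Topology

theorem integrable_of_norm_le_one_add_abs {f : ℝ → ℂ} {C : ℝ} (hf : Continuous f)
    (hb : ∀ y, ‖f y‖ ≤ C * (1 + |y|) ^ (-((2 : ℕ) : ℝ))) : Integrable f := by
  have h : Integrable (fun y : ℝ => C * (1 + ‖y‖) ^ (-((2 : ℕ) : ℝ))) :=
    (integrable_one_add_norm (by norm_num)).const_mul C
  exact h.mono' hf.aestronglyMeasurable (Eventually.of_forall hb)

/-- Moving a vertical line of integration across a strip on which the integrand is holomorphic
and decays quadratically. -/
theorem integral_vertical_line_eq {f : ℂ → ℂ} {p q C : ℝ} (hpq : p ≤ q)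
    (hd : ∀ z : ℂ, z.re ∈ Icc p q → DifferentiableAt ℂ f z)
    (hb : ∀ z : ℂ, z.re ∈ Icc p q → ‖f z‖ ≤ C * (1 + |z.im|) ^ (-((2 : ℕ) : ℝ))) :
    ∫ y : ℝ, f (p + y * I) = ∫ y : ℝ, f (q + y * I) := by
  have hline {x : ℝ} (hx : x ∈ Icc p q) : Integrable fun y : ℝ => f (x + y * I) := by
    refine integrable_of_norm_le_one_add_abs (C := C) ?_ fun y => ?_
    · refine continuous_iff_continuousAt.2 fun y => ?_
      exact ContinuousAt.comp (f := fun y : ℝ => (x + y * I : ℂ))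
        (hd (x + y * I) (by simpa using hx)).continuousAt (by fun_prop)
    · simpa using hb (x + y * I) (by simpa using hx)
  have hvert {x : ℝ} (hx : x ∈ Icc p q) :
      Tendsto (fun T : ℝ => I • ∫ y in (-T)..T, f (x + y * I)) atTop
        (𝓝 (I • ∫ y : ℝ, f (x + y * I))) :=
    (intervalIntegral_tendsto_integral (hline hx) tendsto_neg_atTop_atBot tendsto_id).const_smul I
  have hpow : Tendsto (fun T : ℝ => C * (1 + T) ^ (-((2 : ℕ) : ℝ)) * |q - p|) atTop (𝓝 0) := by
    have h := (tendsto_rpow_neg_atTop (y := ((2 : ℕ) : ℝ)) (by norm_num)).comp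
      (tendsto_atTop_add_const_left atTop (1 : ℝ) tendsto_id)
    simpa using (h.const_mul C).mul_const |q - p|
  have hhor (ε : ℝ) (hε : |ε| = 1) :
      Tendsto (fun T : ℝ => ∫ x in p..q, f (x + (ε * T : ℝ) * I)) atTop (𝓝 0) := by
    refine squeeze_zero_norm' ?_ hpow
    filter_upwards [eventually_ge_atTop 0] with T hT
    refine intervalIntegral.norm_integral_le_of_norm_le_const fun x hx => ?_
    rw [uIoc_of_le hpq] at hx
    have := hb (x + (ε * T : ℝ) * I) (by simpa using ⟨hx.1.le, hx.2⟩)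
    simpa [abs_mul, hε, abs_of_nonneg hT] using this
  have hrect (T : ℝ) : (∫ x in p..q, f (x + ((-1) * T : ℝ) * I)) -
      (∫ x in p..q, f (x + (1 * T : ℝ) * I)) + I • (∫ y in (-T)..T, f (q + y * I)) -
      I • (∫ y in (-T)..T, f (p + y * I)) = 0 := by
    have h := integral_boundary_rect_eq_zero_of_differentiableOn f (p + (-T : ℝ) * I)
      (q + (T : ℝ) * I) fun z hz => by
        refine (hd z ?_).differentiableWithinAt
        have := (mem_reProdIm.1 hz).1
        simpa [uIcc_of_le hpq] using this
    simpa using h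
  have hlim := (((hhor (-1) (by simp)).sub (hhor 1 (by simp))).add
    (hvert (right_mem_Icc.2 hpq))).sub (hvert (left_mem_Icc.2 hpq))
  simp only [hrect] at hlim
  have h0 := tendsto_nhds_unique hlim tendsto_const_nhds
  rw [sub_zero, zero_add, sub_eq_zero] at h0
  exact (smul_right_injective ℂ I_ne_zero h0).symm

end ContourShift

section Slice

/-- A double Barnes integral reduced to a single one by a Thomae transformation in the inner
coordinate, followed by Barnes' first lemma in the outer one. -/
theorem barnes_double {a b c d e f g h k r : ℂ} (hc : 0 < c.re) (hd : 0 < d.re) (he : 0 < e.re)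
    (hg : 0 < g.re) (hh : 0 < h.re) (hk : 0 < k.re) (hr : 0 < r.re) (hra : r.re < a.re)
    (hrb : r.re < b.re) (hrf : 0 < (f - a - b + r).re) :
    Gamma (f - a) * Gamma (f - b) *
      ∫ ζ : ℝ, ∫ τ : ℝ, Gamma (a + τ * I) * Gamma (b + τ * I) * Gamma (c - ζ * I + τ * I) *
        Gamma (d + ζ * I - τ * I) * Gamma (e - τ * I) / Gamma (f + τ * I) *
        (Gamma (g - ζ * I) * Gamma (h - ζ * I) * Gamma (k + ζ * I) / Gamma (c + e - ζ * I)) =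
    2 * Real.pi * (Gamma (c + d) * Gamma (k + g) * Gamma (k + h)) *
      ∫ w : ℝ, Gamma (e + r + w * I) * Gamma (f - a - b + r + w * I) *
        Gamma (d + g + r + w * I) * Gamma (d + h + r + w * I) *
        Gamma (a - r - w * I) * Gamma (b - r - w * I) /
          (Gamma (d + g + h + k + r + w * I) * Gamma (c + d + e + r + w * I)) := by
  have har : 0 < (a - r).re := by simpa using hra
  have hbr : 0 < (b - r).re := by simpa using hrb
  have hdr : 0 < (d + r).re := by simp; linarith
  have her : 0 < (e + r).re := by simp; linarith
  set Φ : ℝ → ℝ → ℂ := fun ζ w => Gamma (d + r + ζ * I + w * I) *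
    (Gamma (g - ζ * I) * Gamma (h - ζ * I) * Gamma (k + ζ * I)) *
    (Gamma (e + r + w * I) * Gamma (f - a - b + r + w * I) * Gamma (a - r - w * I) *
      Gamma (b - r - w * I)) * (Gamma (c + d + e + r + w * I))⁻¹ with hΦ
  have hΦint : Integrable (Function.uncurry Φ) (volume.prod volume) := by
    have h := (((expBound_Gamma_prod hdr 1 1).mul (((expBound_Gamma_prod hg (-1) 0).mul
      (expBound_Gamma_prod hh (-1) 0)).mul (expBound_Gamma_prod hk 1 0))).mul
      ((((expBound_Gamma_prod her 0 1).mul (expBound_Gamma_prod hrf 0 1)).mul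
        (expBound_Gamma_prod har 0 (-1))).mul (expBound_Gamma_prod hbr 0 (-1)))).mul
      (expBound_inv_Gamma_prod (c + d + e + r) 0 1)
    have h2 := h.integrable (μ := volume) fun e => by
      refine (prod_norm_le_abs_add_abs e).trans ?_
      simp only [one_mul, zero_mul, zero_add, add_zero, neg_mul, abs_neg]
      linarith [abs_nonneg e.1, abs_nonneg e.2, abs_nonneg (e.1 + e.2)]
    refine h2.congr (Filter.Eventually.of_forall fun e => ?_)
    simp only [hΦ, Function.uncurry]
    push_cast
    ring_nf
  have h1 (ζ : ℝ) : Gamma (f - a) * Gamma (f - b) * ∫ τ : ℝ,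
        Gamma (a + τ * I) * Gamma (b + τ * I) * Gamma (c - ζ * I + τ * I) *
        Gamma (d + ζ * I - τ * I) * Gamma (e - τ * I) / Gamma (f + τ * I) *
        (Gamma (g - ζ * I) * Gamma (h - ζ * I) * Gamma (k + ζ * I) / Gamma (c + e - ζ * I)) =
      Gamma (c + d) * ∫ w : ℝ, Φ ζ w := by
    have ht := barnes_thomae (a := a) (b := b) (c := c - ζ * I) (d := d + ζ * I) (e := e)
      (f := f) (r := r) (by simpa using hc) (by simpa using hd) he hr hra hrb hrf
    rw [show c - ζ * I + (d + ζ * I) = c + d by ring,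
      show c - ζ * I + e = c + e - ζ * I by ring,
      show d + ζ * I + r = d + r + ζ * I by ring] at ht
    have hne : Gamma (c + e - ζ * I) ≠ 0 := Gamma_ne_zero_of_re_pos (by simp; linarith)
    have hcongr : ∀ w : ℝ, Φ ζ w = (Gamma (g - ζ * I) * Gamma (h - ζ * I) * Gamma (k + ζ * I)) *
        (Gamma (d + r + ζ * I + w * I) * Gamma (e + r + w * I) *
          Gamma (f - a - b + r + w * I) * Gamma (a - r - w * I) * Gamma (b - r - w * I) /
            Gamma (c + d + e + r + w * I)) := fun w => by
      simp only [hΦ]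
      ring
    simp only [hcongr]
    rw [integral_mul_const, integral_const_mul, ← mul_assoc, ht]
    field_simp
  have h2 (w : ℝ) : ∫ ζ : ℝ, Φ ζ w = 2 * Real.pi * (Gamma (k + g) * Gamma (k + h)) *
      (Gamma (e + r + w * I) * Gamma (f - a - b + r + w * I) *
        Gamma (d + g + r + w * I) * Gamma (d + h + r + w * I) *
        Gamma (a - r - w * I) * Gamma (b - r - w * I) /
          (Gamma (d + g + h + k + r + w * I) * Gamma (c + d + e + r + w * I))) := by
    have hb := barnes_first (a := d + r + w * I) (b := k) (c := g) (d := h)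
      (by simpa using hdr) hk hg hh
    rw [show d + r + w * I + g = d + g + r + w * I by ring,
      show d + r + w * I + h = d + h + r + w * I by ring,
      show d + r + w * I + k + g + h = d + g + h + k + r + w * I by ring] at hb
    have hcongr : ∀ ζ : ℝ, Φ ζ w = (Gamma (e + r + w * I) * Gamma (f - a - b + r + w * I) *
        Gamma (a - r - w * I) * Gamma (b - r - w * I) * (Gamma (c + d + e + r + w * I))⁻¹) *
        (Gamma (d + r + w * I + ζ * I) * Gamma (k + ζ * I) * Gamma (g - ζ * I) *
          Gamma (h - ζ * I)) := fun ζ => by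
      simp only [hΦ]
      rw [show d + r + ζ * I + w * I = d + r + w * I + ζ * I by ring]
      ring
    simp only [hcongr]
    rw [integral_const_mul, hb]
    simp only [div_eq_mul_inv, mul_inv]
    ring
  have hswap := integral_integral_swap hΦint
  simp only [h2] at hswap
  rw [integral_const_mul] at hswap
  rw [← integral_const_mul]
  simp only [h1]
  rw [integral_const_mul, hswap]
  ring

/-- The identity between the inner integrals of the two sides of the rearrangement, at a fixed
value of the outer variable `x`. -/
theorem slice_identity {α₁ α₂ α₃ s₀ s x A B : ℂ} (hα₁ : α₁.re = 0) (hα₂ : α₂.re = 0)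
    (hα₃ : α₃.re = 0) (hsum : α₁ + α₂ + α₃ = 0) (hs₀ : s₀.re = 1 / 2) (hs : s.re = 1 / 2)
    (hA₁ : -(1 / 2) < A.re) (hA₂ : A.re < -(1 / 4)) (hB₁ : -(1 / 4) < B.re) (hB₂ : B.re < 0)
    (hx₁ : 1 / 4 - 1 / 200 < x.re) (hx₂ : x.re < 1 / 4) (hx₃ : 1 / 2 - (B.re - A.re) < x.re) :
    2 * Real.pi * (Gamma (x - α₂ / 2) * Gamma (x - α₃ / 2) / Gamma (1 / 2 + x - s₀)) *
      (∫ η : ℝ, Gamma (1 / 200 + η * I) * Gamma (x + 1 / 2 - s - s₀ / 2 + 1 / 200 + η * I) *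
        (Gamma ((s₀ + α₁) / 2 - 1 / 200 - η * I) * Gamma ((s₀ + α₂) / 2 - 1 / 200 - η * I) *
          Gamma ((s₀ + α₃) / 2 - 1 / 200 - η * I)) * Gamma (s - s₀ / 2 - 1 / 200 - η * I) /
        (Gamma (1 / 2 - 1 / 200 - η * I) * Gamma (s₀ / 2 + x - 1 / 200 - η * I))) =
    Gamma ((s₀ + α₁) / 2) / Gamma (1 / 2 - (s₀ + α₁) / 2) *
      ∫ ζ : ℝ, ∫ τ : ℝ, Gamma ((1 - α₁) / 2 + A + τ * I) * Gamma (s + A + τ * I) *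
        Gamma (1 / 2 + A - B - ζ * I + τ * I) * Gamma (x + α₁ / 2 - s + B - A + ζ * I - τ * I) *
        Gamma (-s₀ / 2 - A - τ * I) / Gamma (1 / 2 + s₀ / 2 + A + τ * I) *
        (Gamma (α₂ / 2 - B - ζ * I) * Gamma (α₃ / 2 - B - ζ * I) * Gamma (s₀ / 2 + B + ζ * I) /
          Gamma (1 / 2 - s₀ / 2 - B - ζ * I)) := by
  obtain ⟨V, hV₁, hV₂⟩ := exists_between
    (max_lt (by linarith : -A.re < 1 / 2) (by linarith : 1 / 2 - x.re < 1 / 2))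
  obtain ⟨hV₁, hV₃⟩ := max_lt_iff.1 hV₁
  obtain ⟨ρ, hρ₁, hρ₂⟩ := exists_between
    (max_lt (by linarith : 1 / 2 - V < 1 / 4) (by norm_num : (1 / 200 : ℝ) < 1 / 4))
  obtain ⟨hρ₁, hρ₃⟩ := max_lt_iff.1 hρ₁
  have hα : α₁ = -α₂ - α₃ := by linear_combination hsum
  have n1 : Gamma (1 / 2 + x - s₀) ≠ 0 := Gamma_ne_zero_of_re_pos (by simp [*]; linarith)
  have n2 : Gamma (1 / 2 - (s₀ + α₁) / 2) ≠ 0 :=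
    Gamma_ne_zero_of_re_pos (by simp [*])
  have n3 : Gamma (1 / 2 + s₀ / 2 - s) ≠ 0 := Gamma_ne_zero_of_re_pos (by simp [*])
  have n4 : Gamma (x - α₁ / 2) ≠ 0 := Gamma_ne_zero_of_re_pos (by simp [*]; linarith)
  have n5 : Gamma (s₀ + x - s) ≠ 0 := Gamma_ne_zero_of_re_pos (by simp [*]; linarith)
  have hD := barnes_double (a := (1 - α₁) / 2 + A) (b := s + A) (c := 1 / 2 + A - B)
    (d := x + α₁ / 2 - s + B - A) (e := -s₀ / 2 - A) (f := 1 / 2 + s₀ / 2 + A)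
    (g := α₂ / 2 - B) (h := α₃ / 2 - B) (k := s₀ / 2 + B) (r := V + A)
    (by simp; linarith) (by simp [*]; linarith) (by simp [*]; linarith) (by simp [*])
    (by simp [*]) (by simp [*]; linarith) (by simp; linarith) (by simp [*]; linarith)
    (by simp [*]; linarith) (by simp [*]; linarith)
  have hL := barnes_balanced (a₁ := (s₀ + α₁) / 2 - 1 / 200) (a₂ := s - s₀ / 2 - 1 / 200)
    (a₃ := (s₀ + α₂) / 2 - 1 / 200) (a₄ := (s₀ + α₃) / 2 - 1 / 200) (b₁ := 1 / 200)
    (b₂ := x + 1 / 2 - s - s₀ / 2 + 1 / 200) (c := 1 / 2 - 1 / 200)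
    (d := s₀ / 2 + x - 1 / 200) (r := ρ - 1 / 200) (by simp [*]; norm_num)
    (by simp [*]; norm_num) (by norm_num) (by norm_num [*]; linarith)
    (by rw [hα]; ring) (by norm_num; linarith) (by norm_num [*]; linarith)
    (by norm_num [*]; linarith) (by norm_num [*]; linarith) (by norm_num [*]; linarith)
  have hR := barnes_balanced (a₁ := -s₀ / 2 + V) (a₂ := (s₀ + α₁) / 2 - s + V)
    (a₃ := x - s - α₂ / 2 + V) (a₄ := x - s - α₃ / 2 + V) (b₁ := (1 - α₁) / 2 - V)
    (b₂ := s - V) (c := s₀ / 2 + x - s + V)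
    (d := 1 / 2 + x + α₁ / 2 - s - s₀ / 2 + V) (r := V + ρ - s) (by simp [*]; linarith)
    (by simp [*]; linarith) (by simp [*]; linarith) (by simp [*]; linarith)
    (by rw [hα]; ring) (by norm_num [*]; linarith) (by norm_num [*]; linarith)
    (by norm_num [*]; linarith) (by norm_num [*]; linarith) (by norm_num [*]; linarith)
  obtain ⟨D, hDdef⟩ : ∃ D : ℂ, D = ∫ ζ : ℝ, ∫ τ : ℝ, Gamma ((1 - α₁) / 2 + A + τ * I) *
        Gamma (s + A + τ * I) *
        Gamma (1 / 2 + A - B - ζ * I + τ * I) * Gamma (x + α₁ / 2 - s + B - A + ζ * I - τ * I) *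
        Gamma (-s₀ / 2 - A - τ * I) / Gamma (1 / 2 + s₀ / 2 + A + τ * I) *
        (Gamma (α₂ / 2 - B - ζ * I) * Gamma (α₃ / 2 - B - ζ * I) * Gamma (s₀ / 2 + B + ζ * I) /
          Gamma (1 / 2 - s₀ / 2 - B - ζ * I)) := ⟨_, rfl⟩
  obtain ⟨L, hLdef⟩ : ∃ L : ℂ, L = ∫ η : ℝ, Gamma (1 / 200 + η * I) *
        Gamma (x + 1 / 2 - s - s₀ / 2 + 1 / 200 + η * I) *
        (Gamma ((s₀ + α₁) / 2 - 1 / 200 - η * I) * Gamma ((s₀ + α₂) / 2 - 1 / 200 - η * I) *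
          Gamma ((s₀ + α₃) / 2 - 1 / 200 - η * I)) * Gamma (s - s₀ / 2 - 1 / 200 - η * I) /
        (Gamma (1 / 2 - 1 / 200 - η * I) * Gamma (s₀ / 2 + x - 1 / 200 - η * I)) := ⟨_, rfl⟩
  obtain ⟨R, hRdef⟩ : ∃ R : ℂ, R = ∫ w : ℝ, Gamma (-s₀ / 2 + V + w * I) *
        Gamma ((s₀ + α₁) / 2 - s + V + w * I) * Gamma (x - s - α₂ / 2 + V + w * I) *
        Gamma (x - s - α₃ / 2 + V + w * I) * Gamma ((1 - α₁) / 2 - V - w * I) *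
        Gamma (s - V - w * I) / (Gamma (s₀ / 2 + x - s + V + w * I) *
          Gamma (1 / 2 + x + α₁ / 2 - s - s₀ / 2 + V + w * I)) := ⟨_, rfl⟩
  obtain ⟨J, hJdef⟩ : ∃ J : ℂ, J = ∫ w : ℝ, Gamma (1 / 2 - α₁ / 2 - s + ρ + w * I) *
        Gamma (s₀ / 2 + x - s - α₁ / 2 + ρ + w * I) * Gamma (ρ + w * I) *
        Gamma (x + 1 / 2 - s - s₀ / 2 + ρ + w * I) * Gamma ((s₀ + α₁) / 2 - ρ - w * I) *
        Gamma (s - s₀ / 2 - ρ - w * I) / (Gamma (x + 1 / 2 - s + α₂ / 2 + ρ + w * I) *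
          Gamma (x + 1 / 2 - s + α₃ / 2 + ρ + w * I)) := ⟨_, rfl⟩
  rw [← hDdef, ← hLdef]
  have hD' : Gamma ((s₀ + α₁) / 2) * Gamma (1 / 2 + s₀ / 2 - s) * D =
      2 * Real.pi * (Gamma (1 / 2 + x + α₁ / 2 - s) * Gamma ((s₀ + α₂) / 2) *
        Gamma ((s₀ + α₃) / 2)) * R := by
    have hζ (ζ : ℝ) : 1 / 2 + A - B + (-s₀ / 2 - A) - ζ * I = 1 / 2 - s₀ / 2 - B - ζ * I := by
      ring
    simp only [hζ, ← hDdef] at hD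
    refine Eq.trans ?_ (hD.trans ?_)
    · ring_nf
    · rw [hRdef]
      congr 1
      · ring_nf
      · refine integral_congr_ae (Filter.Eventually.of_forall fun w => ?_)
        simp only [hα]
        ring_nf
  have hL' : Gamma (1 / 2 - (s₀ + α₁) / 2) * Gamma (1 / 2 + s₀ / 2 - s) * Gamma (x - α₁ / 2) *
      Gamma (s₀ + x - s) * L = Gamma ((s₀ + α₂) / 2) * Gamma (x + 1 / 2 - s + α₂ / 2) *
        Gamma ((s₀ + α₃) / 2) * Gamma (x + 1 / 2 - s + α₃ / 2) * J := by
    rw [← integral_neg_eq_self] at hL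
    rw [hLdef, hJdef]
    refine Eq.trans ?_ (hL.trans ?_)
    · congr 1
      · ring_nf
      · refine integral_congr_ae (Filter.Eventually.of_forall fun w => ?_)
        simp only [hα]
        push_cast
        ring_nf
    · congr 1
      · ring_nf
      · refine integral_congr_ae (Filter.Eventually.of_forall fun w => ?_)
        simp only [hα]
        ring_nf
  have hR' : Gamma (s₀ + x - s) * Gamma (x - α₁ / 2) * Gamma (1 / 2 + x + α₁ / 2 - s) *
      Gamma (1 / 2 + x - s₀) * R = Gamma (x + 1 / 2 - s + α₃ / 2) * Gamma (x - α₂ / 2) *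
        Gamma (x + 1 / 2 - s + α₂ / 2) * Gamma (x - α₃ / 2) * J := by
    rw [hRdef, hJdef]
    refine Eq.trans ?_ (hR.trans ?_)
    · congr 1
      ring_nf
    · congr 1
      · rw [hα]
        ring_nf
      · refine integral_congr_ae (Filter.Eventually.of_forall fun w => ?_)
        simp only [hα]
        ring_nf
  rw [div_mul_eq_mul_div, mul_div_assoc', div_mul_eq_mul_div, div_eq_div_iff n1 n2]
  refine mul_left_cancel₀ (mul_ne_zero (mul_ne_zero n3 n4) n5) ?_
  linear_combination (2 * Real.pi * Gamma (x - α₂ / 2) * Gamma (x - α₃ / 2)) * hL' -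
    (Gamma (x - α₁ / 2) * Gamma (s₀ + x - s) * Gamma (1 / 2 + x - s₀)) * hD' -
    (2 * Real.pi * Gamma ((s₀ + α₂) / 2) * Gamma ((s₀ + α₃) / 2)) * hR'

end Slice

section KernelLine

/-- The part of the kernel integrand that depends on the outer variable `x = s₁ / 2` only. -/
noncomputable def outerFactor (α₁ α₂ α₃ s₀ s μ x : ℂ) : ℂ :=
  Gamma ((s + μ) / 2 - x) * Gamma ((s - μ) / 2 - x) *
    (Gamma (x - α₁ / 2) * Gamma (x - α₂ / 2) * Gamma (x - α₃ / 2)) * (Gamma (1 / 2 + x - s₀))⁻¹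

/-- The remaining part of the kernel integrand, at `u / 2 = 1 / 200 + η * I`. -/
noncomputable def innerFactor (α₁ α₂ α₃ s₀ s x : ℂ) (η : ℝ) : ℂ :=
  Gamma (1 / 200 + η * I) * Gamma (x + 1 / 2 - s - s₀ / 2 + 1 / 200 + η * I) *
    (Gamma ((s₀ + α₁) / 2 - 1 / 200 - η * I) * Gamma ((s₀ + α₂) / 2 - 1 / 200 - η * I) *
      Gamma ((s₀ + α₃) / 2 - 1 / 200 - η * I)) * Gamma (s - s₀ / 2 - 1 / 200 - η * I) /
    (Gamma (1 / 2 - 1 / 200 - η * I) * Gamma (s₀ / 2 + x - 1 / 200 - η * I))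

theorem expBound_Gamma_add_strip {p q : ℝ} {κ : ℂ → ℂ} (hκ : Continuous κ)
    (hre : ∀ z, p ≤ (κ z).re ∧ (κ z).re ≤ q) (him : ∀ z, (κ z).im = z.im) {c : ℂ}
    (hc : 0 < c.re + p) : ExpBound (fun z => Gamma (c + κ z)) (fun z => |z.im|) :=
  expBound_Gamma (r := c.re + p) (R := c.re + q) (m := c.im) imCLM (by fun_prop) hc
    (fun z => by simpa using hre z) (fun z => by simp [him])

theorem expBound_Gamma_sub_strip {p q : ℝ} {κ : ℂ → ℂ} (hκ : Continuous κ)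
    (hre : ∀ z, p ≤ (κ z).re ∧ (κ z).re ≤ q) (him : ∀ z, (κ z).im = z.im) {c : ℂ}
    (hc : 0 < c.re - q) : ExpBound (fun z => Gamma (c - κ z)) (fun z => |z.im|) := by
  have h := expBound_Gamma (g := fun z => c - κ z) (r := c.re - q) (R := c.re - p) (m := c.im)
    (-imCLM) (by fun_prop) hc
    (fun z => by rw [sub_re]; exact ⟨by linarith [(hre z).2], by linarith [(hre z).1]⟩)
    (fun z => by simp [him, sub_eq_add_neg])
  simpa using h

theorem expBound_inv_Gamma_add_strip {p q : ℝ} {κ : ℂ → ℂ} (hκ : Continuous κ)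
    (hre : ∀ z, p ≤ (κ z).re ∧ (κ z).re ≤ q) (him : ∀ z, (κ z).im = z.im) (c : ℂ) :
    ExpBound (fun z => (Gamma (c + κ z))⁻¹) (fun z => -|z.im|) :=
  expBound_inv_Gamma (r := c.re + p) (R := c.re + q) (m := c.im) imCLM (by fun_prop)
    (fun z => by simpa using hre z) (fun z => by simp [him])

theorem differentiableAt_Gamma_of_re_pos {z : ℂ} (hz : 0 < z.re) : DifferentiableAt ℂ Gamma z :=
  differentiableAt_Gamma _ fun k hk => by
    rw [hk, neg_re, natCast_re] at hz
    linarith [k.cast_nonneg (α := ℝ)]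

theorem kernel_integral_line_eq {α₁ α₂ α₃ s₀ s μ : ℂ} (hα₁ : α₁.re = 0) (hα₂ : α₂.re = 0)
    (hα₃ : α₃.re = 0) (hs₀ : s₀.re = 1 / 2) (hs : s.re = 1 / 2) (hμ : μ.re = 0) {p q : ℝ}
    (hp : 1 / 4 - 1 / 200 < p) (hpq : p ≤ q) (hq : q < 1 / 4) (η : ℝ) :
    ∫ ξ : ℝ, outerFactor α₁ α₂ α₃ s₀ s μ (p + ξ * I) *
        innerFactor α₁ α₂ α₃ s₀ s (p + ξ * I) η =
      ∫ ξ : ℝ, outerFactor α₁ α₂ α₃ s₀ s μ (q + ξ * I) *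
        innerFactor α₁ α₂ α₃ s₀ s (q + ξ * I) η := by
  set D : ℂ := Gamma (1 / 200 + η * I) *
    (Gamma ((s₀ + α₁) / 2 - 1 / 200 - η * I) * Gamma ((s₀ + α₂) / 2 - 1 / 200 - η * I) *
      Gamma ((s₀ + α₃) / 2 - 1 / 200 - η * I)) * Gamma (s - s₀ / 2 - 1 / 200 - η * I) /
    Gamma (1 / 2 - 1 / 200 - η * I) with hD
  set G : ℂ → ℂ := fun x => Gamma ((s + μ) / 2 - x) * Gamma ((s - μ) / 2 - x) *
    (Gamma (-α₁ / 2 + x) * Gamma (-α₂ / 2 + x) * Gamma (-α₃ / 2 + x)) *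
    Gamma (1 / 2 - s - s₀ / 2 + 1 / 200 + η * I + x) * (Gamma (1 / 2 - s₀ + x))⁻¹ *
    (Gamma (s₀ / 2 - 1 / 200 - η * I + x))⁻¹ with hG
  have hfac (x : ℂ) : outerFactor α₁ α₂ α₃ s₀ s μ x * innerFactor α₁ α₂ α₃ s₀ s x η =
      D * G x := by
    rw [outerFactor, innerFactor, hD, hG]
    ring_nf
  simp only [hfac, integral_const_mul]
  congr 1
  set κ : ℂ → ℂ := fun z => (max p (min q z.re) : ℝ) + z.im * I with hκdef
  have hκ : Continuous κ := by fun_prop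
  have hre (z : ℂ) : p ≤ (κ z).re ∧ (κ z).re ≤ q := by simp [hκdef, hpq]
  have him (z : ℂ) : (κ z).im = z.im := by simp [hκdef]
  have hκz {z : ℂ} (hz : z.re ∈ Icc p q) : κ z = z := by
    apply Complex.ext <;> simp [hκdef, hz.1, hz.2]
  have r1 : 0 < ((s + μ) / 2).re - q := by simp [*]; linarith
  have r2 : 0 < ((s - μ) / 2).re - q := by simp [*]; linarith
  have r3 : 0 < (-α₁ / 2).re + p := by simp [*]; linarith
  have r4 : 0 < (-α₂ / 2).re + p := by simp [*]; linarith
  have r5 : 0 < (-α₃ / 2).re + p := by simp [*]; linarith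
  have r6 : 0 < (1 / 2 - s - s₀ / 2 + 1 / 200 + η * I).re + p := by norm_num [*]; linarith
  have hbound := ((((((expBound_Gamma_sub_strip hκ hre him r1).mul
    (expBound_Gamma_sub_strip hκ hre him r2)).mul (((expBound_Gamma_add_strip hκ hre him r3).mul
    (expBound_Gamma_add_strip hκ hre him r4)).mul (expBound_Gamma_add_strip hκ hre him r5))).mul
    (expBound_Gamma_add_strip hκ hre him r6)).mul
    (expBound_inv_Gamma_add_strip hκ hre him (1 / 2 - s₀))).mul
    (expBound_inv_Gamma_add_strip hκ hre him (s₀ / 2 - 1 / 200 - η * I)))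
  obtain ⟨C, hC, hb⟩ := hbound.exists_rpow_bound (S := {z | z.re ∈ Icc p q}) (K := 1)
    (fun z hz => by
      have h1 := norm_le_abs_re_add_abs_im z
      have h2 : |z.re| ≤ 1 := abs_le.2 ⟨by linarith [hz.1], by linarith [hz.2]⟩
      linarith [abs_nonneg z.im]) 2
  refine integral_vertical_line_eq (f := G) (C := C) hpq (fun z hz => ?_) fun z hz => ?_
  · have dsub {c : ℂ} (hc : 0 < c.re - q) : DifferentiableAt ℂ (fun x => Gamma (c - x)) z :=
      (differentiableAt_Gamma_of_re_pos (by simp; linarith [hz.2])).comp z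
        (f := fun x => c - x) (by fun_prop)
    have dadd {c : ℂ} (hc : 0 < c.re + p) : DifferentiableAt ℂ (fun x => Gamma (c + x)) z :=
      (differentiableAt_Gamma_of_re_pos (by simp; linarith [hz.1])).comp z
        (f := fun x => c + x) (by fun_prop)
    have dinv (c : ℂ) : DifferentiableAt ℂ (fun x => (Gamma (c + x))⁻¹) z :=
      (differentiable_one_div_Gamma _).comp z (f := fun x => c + x) (by fun_prop)
    exact (((((dsub r1).mul (dsub r2)).mul (((dadd r3).mul (dadd r4)).mul (dadd r5))).mul
      (dadd r6)).mul (dinv _)).mul (dinv _)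
  · have h := hb z hz
    simp only [hκz hz] at h
    refine h.trans (mul_le_mul_of_nonneg_left ?_ hC)
    exact Real.rpow_le_rpow_of_nonpos (by positivity)
      (by linarith [abs_im_le_norm z]) (by norm_num)

theorem integrable_kernel {α₁ α₂ α₃ s₀ s μ : ℂ} (hα₁ : α₁.re = 0) (hα₂ : α₂.re = 0)
    (hα₃ : α₃.re = 0) (hs₀ : s₀.re = 1 / 2) (hs : s.re = 1 / 2) (hμ : μ.re = 0) {p : ℝ}
    (hp : 1 / 4 - 1 / 200 < p) (hq : p < 1 / 4) :
    Integrable (Function.uncurry fun ξ η : ℝ => outerFactor α₁ α₂ α₃ s₀ s μ (p + ξ * I) *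
      innerFactor α₁ α₂ α₃ s₀ s (p + ξ * I) η) (volume.prod volume) := by
  have r1 : 0 < ((s + μ) / 2 - p).re := by simp [*]; linarith
  have r2 : 0 < ((s - μ) / 2 - p).re := by simp [*]; linarith
  have r3 : 0 < (p - α₁ / 2).re := by simp [*]; linarith
  have r4 : 0 < (p - α₂ / 2).re := by simp [*]; linarith
  have r5 : 0 < (p - α₃ / 2).re := by simp [*]; linarith
  have r6 : 0 < (p + 1 / 2 - s - s₀ / 2 + 1 / 200).re := by norm_num [*]; linarith
  have r7 : 0 < (1 / 200 : ℂ).re := by norm_num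
  have r8 : 0 < ((s₀ + α₁) / 2 - 1 / 200).re := by norm_num [*]
  have r9 : 0 < ((s₀ + α₂) / 2 - 1 / 200).re := by norm_num [*]
  have r10 : 0 < ((s₀ + α₃) / 2 - 1 / 200).re := by norm_num [*]
  have r11 : 0 < (s - s₀ / 2 - 1 / 200).re := by norm_num [*]
  have h := ((((expBound_Gamma_prod r1 (-1) 0).mul (expBound_Gamma_prod r2 (-1) 0)).mul
    (((expBound_Gamma_prod r3 1 0).mul (expBound_Gamma_prod r4 1 0)).mul
      (expBound_Gamma_prod r5 1 0))).mul (expBound_inv_Gamma_prod (1 / 2 + p - s₀) 1 0)).mul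
    (((((expBound_Gamma_prod r7 0 1).mul (expBound_Gamma_prod r6 1 1)).mul
    (((expBound_Gamma_prod r8 0 (-1)).mul (expBound_Gamma_prod r9 0 (-1))).mul
      (expBound_Gamma_prod r10 0 (-1)))).mul (expBound_Gamma_prod r11 0 (-1))).mul
    ((expBound_inv_Gamma_prod (1 / 2 - 1 / 200) 0 (-1)).mul
      (expBound_inv_Gamma_prod (s₀ / 2 + p - 1 / 200) 1 (-1))))
  have h2 := h.integrable (μ := volume) fun e => by
    refine (prod_norm_le_abs_add_abs e).trans ?_
    simp only [one_mul, zero_mul, zero_add, add_zero, neg_mul, abs_neg]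
    have : |e.1 + -e.2| ≤ |e.1| + |e.2| := (abs_add_le _ _).trans_eq (by rw [abs_neg])
    linarith [abs_nonneg e.1, abs_nonneg e.2, abs_nonneg (e.1 + e.2)]
  refine h2.congr (Filter.Eventually.of_forall fun e => ?_)
  simp only [Function.uncurry, outerFactor, innerFactor]
  push_cast
  ring_nf

theorem kernel_double_integral_line_eq {α₁ α₂ α₃ s₀ s μ : ℂ} (hα₁ : α₁.re = 0)
    (hα₂ : α₂.re = 0) (hα₃ : α₃.re = 0) (hs₀ : s₀.re = 1 / 2) (hs : s.re = 1 / 2)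
    (hμ : μ.re = 0) {p q : ℝ} (hp : 1 / 4 - 1 / 200 < p) (hpq : p ≤ q) (hq : q < 1 / 4) :
    ∫ ξ : ℝ, ∫ η : ℝ, outerFactor α₁ α₂ α₃ s₀ s μ (p + ξ * I) *
        innerFactor α₁ α₂ α₃ s₀ s (p + ξ * I) η =
      ∫ ξ : ℝ, ∫ η : ℝ, outerFactor α₁ α₂ α₃ s₀ s μ (q + ξ * I) *
        innerFactor α₁ α₂ α₃ s₀ s (q + ξ * I) η := by
  rw [integral_integral_swap
      (integrable_kernel hα₁ hα₂ hα₃ hs₀ hs hμ hp (hpq.trans_lt hq)),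
    integral_integral_swap (integrable_kernel hα₁ hα₂ hα₃ hs₀ hs hμ (hp.trans_le hpq) hq)]
  exact integral_congr_ae (Filter.Eventually.of_forall fun η =>
    kernel_integral_line_eq hα₁ hα₂ hα₃ hs₀ hs hμ hp hpq hq η)

end KernelLine

section Rearrangement

/-- Coordinate form of `expBound_Gamma` on three-dimensional space. -/
theorem expBound_Gamma_triple {p : ℂ} (hp : 0 < p.re) (k l m : ℝ) :
    ExpBound (fun e : ℝ × ℝ × ℝ => Gamma (p + (k * e.1 + l * e.2.1 + m * e.2.2 : ℝ) * I))
      (fun e => |k * e.1 + l * e.2.1 + m * e.2.2|) :=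
  expBound_Gamma (R := p.re) (m := p.im)
    (k • ContinuousLinearMap.fst ℝ ℝ (ℝ × ℝ) +
      l • (ContinuousLinearMap.fst ℝ ℝ ℝ).comp (ContinuousLinearMap.snd ℝ ℝ (ℝ × ℝ)) +
      m • (ContinuousLinearMap.snd ℝ ℝ ℝ).comp (ContinuousLinearMap.snd ℝ ℝ (ℝ × ℝ)))
    (by fun_prop) hp (fun e => by simp) (fun e => by simp)

/-- Coordinate form of `expBound_inv_Gamma` on three-dimensional space. -/
theorem expBound_inv_Gamma_triple (p : ℂ) (k l m : ℝ) :
    ExpBound (fun e : ℝ × ℝ × ℝ => (Gamma (p + (k * e.1 + l * e.2.1 + m * e.2.2 : ℝ) * I))⁻¹)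
      (fun e => -|k * e.1 + l * e.2.1 + m * e.2.2|) :=
  expBound_inv_Gamma (r := p.re) (R := p.re) (m := p.im)
    (k • ContinuousLinearMap.fst ℝ ℝ (ℝ × ℝ) +
      l • (ContinuousLinearMap.fst ℝ ℝ ℝ).comp (ContinuousLinearMap.snd ℝ ℝ (ℝ × ℝ)) +
      m • (ContinuousLinearMap.snd ℝ ℝ ℝ).comp (ContinuousLinearMap.snd ℝ ℝ (ℝ × ℝ)))
    (by fun_prop) (fun e => by simp) (fun e => by simp)

theorem integral_integral_integral_reverse {Ψ : ℝ → ℝ → ℝ → ℂ}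
    (h : Integrable (fun e : ℝ × ℝ × ℝ => Ψ e.1 e.2.1 e.2.2)) :
    ∫ τ, ∫ ζ, ∫ ξ, Ψ τ ζ ξ = ∫ ξ, ∫ ζ, ∫ τ, Ψ τ ζ ξ := by
  calc ∫ τ, ∫ ζ, ∫ ξ, Ψ τ ζ ξ = ∫ τ, ∫ p : ℝ × ℝ, Ψ τ p.1 p.2 :=
        integral_congr_ae (h.prod_right_ae.mono fun τ hτ => (integral_prod _ hτ).symm)
    _ = ∫ p : ℝ × ℝ, ∫ τ, Ψ τ p.1 p.2 := integral_integral_swap h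
    _ = _ := integral_prod_symm _ h.integral_prod_right

theorem integral_eq_two_mul_integral_comp_two_mul (g : ℝ → ℂ) :
    ∫ t, g t = 2 * ∫ t, g (2 * t) := by
  rw [Measure.integral_comp_mul_left, abs_of_pos (by norm_num), real_smul]
  push_cast
  ring

/-- The integrand over `(t, z, x)` interpolating between the two sides of the rearrangement. -/
noncomputable def tripleIntegrand (α₁ α₂ α₃ s₀ s μ A B x : ℂ) (τ ζ : ℝ) : ℂ :=
  Gamma ((s + μ) / 2 - x) * Gamma ((s - μ) / 2 - x) * Gamma (x - α₁ / 2) *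
    (Gamma ((1 - α₁) / 2 + A + τ * I) * Gamma (s + A + τ * I) *
      Gamma (1 / 2 + A - B - ζ * I + τ * I) * Gamma (x + α₁ / 2 - s + B - A + ζ * I - τ * I) *
      Gamma (-s₀ / 2 - A - τ * I) / Gamma (1 / 2 + s₀ / 2 + A + τ * I) *
      (Gamma (α₂ / 2 - B - ζ * I) * Gamma (α₃ / 2 - B - ζ * I) * Gamma (s₀ / 2 + B + ζ * I) /
        Gamma (1 / 2 - s₀ / 2 - B - ζ * I)))

theorem integrable_tripleIntegrand {α₁ α₂ α₃ s₀ s μ A B : ℂ} (hα₁ : α₁.re = 0)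
    (hα₂ : α₂.re = 0) (hα₃ : α₃.re = 0) (hs₀ : s₀.re = 1 / 2) (hs : s.re = 1 / 2)
    (hμ : μ.re = 0) (hA₁ : -(1 / 2) < A.re) (hA₂ : A.re < -(1 / 4)) (hB₁ : -(1 / 4) < B.re)
    (hB₂ : B.re < 0) {X : ℝ} (hX₁ : 0 < X) (hX₂ : X < 1 / 4)
    (hX₃ : 1 / 2 - (B.re - A.re) < X) :
    Integrable (fun e : ℝ × ℝ × ℝ =>
      tripleIntegrand α₁ α₂ α₃ s₀ s μ A B (X + e.2.2 * I) e.1 e.2.1) := by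
  have r1 : 0 < ((s + μ) / 2 - X).re := by simp [*]; linarith
  have r2 : 0 < ((s - μ) / 2 - X).re := by simp [*]; linarith
  have r3 : 0 < (X - α₁ / 2).re := by simp [*]
  have r4 : 0 < ((1 - α₁) / 2 + A).re := by simp [*]; linarith
  have r5 : 0 < (s + A).re := by simp [*]; linarith
  have r6 : 0 < (1 / 2 + A - B).re := by simp [*]; linarith
  have r7 : 0 < (X + α₁ / 2 - s + B - A).re := by simp [*]; linarith
  have r8 : 0 < (-s₀ / 2 - A).re := by simp [*]; linarith
  have r9 : 0 < (α₂ / 2 - B).re := by simp [*]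
  have r10 : 0 < (α₃ / 2 - B).re := by simp [*]
  have r11 : 0 < (s₀ / 2 + B).re := by simp [*]; linarith
  have h := (((expBound_Gamma_triple r1 0 0 (-1)).mul (expBound_Gamma_triple r2 0 0 (-1))).mul
    (expBound_Gamma_triple r3 0 0 1)).mul
    (((((((expBound_Gamma_triple r4 1 0 0).mul (expBound_Gamma_triple r5 1 0 0)).mul
      (expBound_Gamma_triple r6 1 (-1) 0)).mul (expBound_Gamma_triple r7 (-1) 1 1)).mul
      (expBound_Gamma_triple r8 (-1) 0 0)).mul
      (expBound_inv_Gamma_triple (1 / 2 + s₀ / 2 + A) 1 0 0)).mul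
      ((((expBound_Gamma_triple r9 0 (-1) 0).mul (expBound_Gamma_triple r10 0 (-1) 0)).mul
        (expBound_Gamma_triple r11 0 1 0)).mul
        (expBound_inv_Gamma_triple (1 / 2 - s₀ / 2 - B) 0 (-1) 0)))
  have hprod : (volume : Measure (ℝ × ℝ)).IsAddHaarMeasure :=
    Measure.prod.instIsAddHaarMeasure volume volume
  have hprod' : (volume : Measure (ℝ × ℝ × ℝ)).IsAddHaarMeasure :=
    Measure.prod.instIsAddHaarMeasure volume volume
  have h2 := h.integrable (μ := volume) fun e => by
    have h1 : ‖e‖ ≤ |e.1| + (|e.2.1| + |e.2.2|) := by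
      rw [Prod.norm_def, Real.norm_eq_abs]
      have := prod_norm_le_abs_add_abs e.2
      exact max_le (by linarith [abs_nonneg e.2.1, abs_nonneg e.2.2])
        (by linarith [abs_nonneg e.1])
    refine h1.trans ?_
    simp only [one_mul, zero_mul, zero_add, add_zero, neg_mul, abs_neg]
    linarith [abs_nonneg e.1, abs_nonneg e.2.1, abs_nonneg e.2.2, abs_nonneg (e.1 + -e.2.1),
      abs_nonneg (-e.1 + e.2.1 + e.2.2)]
  refine h2.congr (Filter.Eventually.of_forall fun e => ?_)
  simp only [tripleIntegrand]
  push_cast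
  ring_nf

end Rearrangement

/-- Ishii–Stade rearrangement of the kernel `K_{σ₁}(s₀,s;α,μ)` (Theorem 9.7 of the
paper), valid on the critical lines `Re s₀ = Re s = 1/2` for tempered parameters. -/
theorem ishii_stade_rearrangement
    (α : Fin 3 → ℂ) (hre : ∀ i, (α i).re = 0) (hsum : α 0 + α 1 + α 2 = 0)
    (μ : ℂ) (hμ : μ.re = 0)
    (s0 s : ℂ) (h0 : s0.re = 1/2) (hs : s.re = 1/2)
    (σ1 : ℝ) (hσa : 1/2 - 1/100 < σ1) (hσb : σ1 < 1/2)
    (a b : ℝ) (ha₁ : -(1/2) < a) (ha₂ : a < -(1/4)) (hb₁ : -(1/4) < b) (hb₂ : b < 0)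
    (hab : 1/4 < b - a) :
    Kker σ1 s0 s α μ =
      4 * gamRatio (-(s0 + α 0) / 2) * Complex.Gamma ((s + μ - α 0) / 2) *
        Complex.Gamma ((s - μ - α 0) / 2) *
        ((1 / (2 * (Real.pi : ℂ))) ^ 2 *
          ∫ τ : ℝ, ∫ ζ : ℝ,
            let t : ℂ := (a : ℝ) + τ * Complex.I
            let z : ℂ := (b : ℝ) + ζ * Complex.I
            Complex.Gamma (s + t) * Complex.Gamma ((1 - α 0) / 2 + t) *
              Complex.Gamma (α 1 / 2 + α 0 / 4 - z) *
              Complex.Gamma (α 2 / 2 + α 0 / 4 - z) *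
              Complex.Gamma ((-s + μ) / 2 + α 0 / 4 + z - t) *
              Complex.Gamma ((-s - μ) / 2 + α 0 / 4 + z - t) *
              (gamRatio (t + s0 / 2) * gamRatio (α 0 / 4 - z - s0 / 2) /
                gamRatio (α 0 / 4 + t - z))) := by
  obtain ⟨X, hX₁, hX₂⟩ := exists_between
    (max_lt (by linarith : σ1 / 2 < 1 / 4) (by linarith : 1 / 2 - (b - a) < 1 / 4))
  obtain ⟨hX₁, hX₃⟩ := max_lt_iff.1 hX₁
  have hpi : (Real.pi : ℂ) ≠ 0 := by exact_mod_cast Real.pi_ne_zero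
  have hB : ((b : ℂ) - α 0 / 4).re = b := by simp [hre]
  set γ : ℂ := Gamma ((s0 + α 0) / 2) / Gamma (1 / 2 - (s0 + α 0) / 2) with hγ
  have hleft : Kker σ1 s0 s α μ = (1 / (2 * (Real.pi : ℂ))) ^ 2 *
      (4 * ∫ ξ : ℝ, ∫ η : ℝ, outerFactor (α 0) (α 1) (α 2) s0 s μ ((σ1 / 2 : ℝ) + ξ * I) *
        innerFactor (α 0) (α 1) (α 2) s0 s ((σ1 / 2 : ℝ) + ξ * I) η) := by
    rw [Kker, integral_eq_two_mul_integral_comp_two_mul]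
    congr 1
    rw [show (4 : ℂ) = 2 * 2 by norm_num, mul_assoc]
    congr 1
    rw [← integral_const_mul]
    refine integral_congr_ae (Filter.Eventually.of_forall fun ξ => ?_)
    simp only
    rw [integral_eq_two_mul_integral_comp_two_mul]
    congr 1
    refine integral_congr_ae (Filter.Eventually.of_forall fun η => ?_)
    simp only [outerFactor, innerFactor, Fin.prod_univ_three]
    push_cast
    ring_nf
  have hslice (ξ : ℝ) : ∫ η : ℝ, outerFactor (α 0) (α 1) (α 2) s0 s μ (X + ξ * I) *
        innerFactor (α 0) (α 1) (α 2) s0 s (X + ξ * I) η =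
      γ / (2 * Real.pi) * ∫ ζ : ℝ, ∫ τ : ℝ,
        tripleIntegrand (α 0) (α 1) (α 2) s0 s μ a (b - α 0 / 4) (X + ξ * I) τ ζ := by
    have h := slice_identity (x := X + ξ * I) (A := a) (B := b - α 0 / 4) (hre 0) (hre 1) (hre 2)
      hsum h0 hs (by simpa using ha₁) (by simpa using ha₂) (by rwa [hB]) (by rwa [hB])
      (by simp; linarith) (by simpa using hX₂) (by rw [hB]; simpa using hX₃)
    simp only [tripleIntegrand, integral_const_mul, outerFactor]
    simp only [innerFactor]
    rw [div_mul_eq_mul_div, eq_div_iff (by simp [hpi])]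
    linear_combination (Gamma ((s + μ) / 2 - (X + ξ * I)) * Gamma ((s - μ) / 2 - (X + ξ * I)) *
      Gamma (X + ξ * I - α 0 / 2)) * h
  have hbarnes (τ ζ : ℝ) : ∫ ξ : ℝ,
      tripleIntegrand (α 0) (α 1) (α 2) s0 s μ a (b - α 0 / 4) (X + ξ * I) τ ζ =
      2 * Real.pi * (Gamma ((s + μ - α 0) / 2) * Gamma ((s - μ - α 0) / 2)) *
      (let t : ℂ := (a : ℝ) + τ * I
       let z : ℂ := (b : ℝ) + ζ * I
       Gamma (s + t) * Gamma ((1 - α 0) / 2 + t) * Gamma (α 1 / 2 + α 0 / 4 - z) *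
         Gamma (α 2 / 2 + α 0 / 4 - z) * Gamma ((-s + μ) / 2 + α 0 / 4 + z - t) *
         Gamma ((-s - μ) / 2 + α 0 / 4 + z - t) *
         (gamRatio (t + s0 / 2) * gamRatio (α 0 / 4 - z - s0 / 2) /
           gamRatio (α 0 / 4 + t - z))) := by
    have h := barnes_first (a := X - α 0 / 2)
      (b := X + α 0 / 2 - s + (b - α 0 / 4) - a + ζ * I - τ * I)
      (c := (s + μ) / 2 - X) (d := (s - μ) / 2 - X) (by simp [hre]; linarith)
      (by simp [hre, hs]; linarith) (by simp [hs, hμ]; linarith) (by simp [hs, hμ]; linarith)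
    have hcongr (ξ : ℝ) :
        tripleIntegrand (α 0) (α 1) (α 2) s0 s μ a (b - α 0 / 4) (X + ξ * I) τ ζ =
        (Gamma ((1 - α 0) / 2 + a + τ * I) * Gamma (s + a + τ * I) *
          Gamma (1 / 2 + a - (b - α 0 / 4) - ζ * I + τ * I) *
          Gamma (-s0 / 2 - a - τ * I) / Gamma (1 / 2 + s0 / 2 + a + τ * I) *
          (Gamma (α 1 / 2 - (b - α 0 / 4) - ζ * I) * Gamma (α 2 / 2 - (b - α 0 / 4) - ζ * I) *
            Gamma (s0 / 2 + (b - α 0 / 4) + ζ * I) /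
            Gamma (1 / 2 - s0 / 2 - (b - α 0 / 4) - ζ * I))) *
        (Gamma (X - α 0 / 2 + ξ * I) *
          Gamma (X + α 0 / 2 - s + (b - α 0 / 4) - a + ζ * I - τ * I + ξ * I) *
          Gamma ((s + μ) / 2 - X - ξ * I) * Gamma ((s - μ) / 2 - X - ξ * I)) := by
      rw [tripleIntegrand]
      ring_nf
    simp only [hcongr]
    rw [integral_const_mul, h]
    simp only [gamRatio, div_eq_mul_inv, mul_inv, inv_inv]
    ring_nf
  have htriple := integral_integral_integral_reverse (Ψ := fun τ ζ ξ =>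
      tripleIntegrand (α 0) (α 1) (α 2) s0 s μ a (b - α 0 / 4) (X + ξ * I) τ ζ)
    (integrable_tripleIntegrand
    (A := a) (B := b - α 0 / 4) (X := X) (hre 0) (hre 1) (hre 2) h0 hs hμ
    (by simpa using ha₁) (by simpa using ha₂) (by rwa [hB]) (by rwa [hB])
    (by linarith) hX₂ (by rw [hB]; simpa using hX₃))
  simp only [hbarnes, integral_const_mul] at htriple
  rw [hleft, kernel_double_integral_line_eq (hre 0) (hre 1) (hre 2) h0 hs hμ
    (by linarith : 1 / 4 - 1 / 200 < σ1 / 2) hX₁.le hX₂]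
  simp only [hslice, integral_const_mul]
  rw [← htriple]
  have hgam : gamRatio (-(s0 + α 0) / 2) = γ := by
    rw [gamRatio, hγ]
    ring_nf
  rw [hgam]
  have hconst (c G G' J : ℂ) : (1 / (2 * (Real.pi : ℂ))) ^ 2 *
      (4 * (c / (2 * Real.pi) * (2 * Real.pi * (G * G') * J))) =
      4 * c * G * G' * ((1 / (2 * (Real.pi : ℂ))) ^ 2 * J) := by
    field_simp
  exact hconst _ _ _ _
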